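/- Let R be a one-dimensional Cohen–Macaulay local ring with canonical module K_R and let I be a faithful ideal of R. Set I^∨ = Hom_R(I, K_R), r = μ_R(I), and s = μ_R(I^∨). Assume the canonical map t : I ⊗_R I^∨ → K_R, x ⊗ f ↦ f(x), is an isomorphism. If r ≥ 2 and s ≥ 2, then e(R) > (r+1)s ≥ 6. -/

import Mathlib

open CategoryTheory TensorProduct

noncomputable section

/-- Minimal number of generators of a submodule. -/
def minGen (R : Type*) {M : Type*} [Semiring R] [AddCommMonoid M] [Module R M]
    (p : Submodule R M) : ℕ :=
  sInf {n | ∃ s : Finset M, s.card = n ∧ Submodule.span R (s : Set M) = p}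

/-- Length of a module, as the height of `⊤` in its lattice of submodules. -/
def moduleLength (R M : Type*) [Ring R] [AddCommGroup M] [Module R M] : ℕ∞ :=
  Order.height (⊤ : Submodule R M)

/-- `e` is the (Hilbert–Samuel) multiplicity of the one-dimensional local ring `(R, m)`:
the first difference of the Hilbert–Samuel function `n ↦ ℓ_R(R/mⁿ)` is eventually
equal to `e`. -/
def IsMultiplicityAt (R : Type*) [CommRing R] (m : Ideal R) (e : ℕ) : Prop :=
  ∃ N : ℕ, ∀ n ≥ N,
    moduleLength R (R ⧸ (m ^ (n + 1))) = moduleLength R (R ⧸ (m ^ n)) + e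

/-- The `i`-th Ext module `Ext_R^i(M, N)`. -/
def extMod (R : Type u) [CommRing R] (M N : ModuleCat.{u} R) (i : ℕ) : ModuleCat R :=
  ((Ext R (ModuleCat.{u} R) i).obj (Opposite.op M)).obj N

/-- `K` is a canonical module of the one-dimensional Cohen–Macaulay local ring `R` with
maximal ideal `m`, via the Bass-number characterization:
`Ext^i(R/m, K) = 0` for `i ≠ 1` and `Ext^1(R/m, K) ≅ R/m`. -/
def IsCanonicalModuleAt (R : Type u) [CommRing R] (m : Ideal R)
    (K : Type u) [AddCommGroup K] [Module R K] : Prop :=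
  Module.Finite R K ∧
  (∀ i : ℕ, i ≠ 1 →
    Subsingleton (extMod R (ModuleCat.of R (R ⧸ m)) (ModuleCat.of R K) i)) ∧
  Nonempty ((extMod R (ModuleCat.of R (R ⧸ m)) (ModuleCat.of R K) 1) ≅
    ModuleCat.of R (R ⧸ m))

/-- The evaluation map `I ⊗_R Hom_R(I, K) → K`, `x ⊗ f ↦ f x`. -/
def evalMap (R : Type*) [CommRing R] {M : Type*} [AddCommGroup M] [Module R M]
    (I : Submodule R M) (K : Type*) [AddCommGroup K] [Module R K] :
    (I ⊗[R] (I →ₗ[R] K)) →ₗ[R] K :=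
  TensorProduct.lift LinearMap.applyₗ

/-- A fractional ideal `I` of `R` with `FI = F`: a finitely generated `R`-submodule of the
total ring of fractions `F = Q(R)` containing a unit of `F`. -/
def IsFracIdealUnit (R : Type*) [CommRing R] (I : Submodule R (FractionRing R)) : Prop :=
  I.FG ∧ ∃ x ∈ I, IsUnit x

/-- A one-dimensional Cohen–Macaulay local ring: Noetherian, local, Krull dimension one,
and the maximal ideal contains a nonzerodivisor. -/
def IsOneDimCMLocal (R : Type*) [CommRing R] [IsLocalRing R] : Prop :=
  IsNoetherianRing R ∧ ringKrullDim R = 1 ∧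
    ∃ x ∈ IsLocalRing.maximalIdeal R, x ∈ nonZeroDivisors R

/-- The colon `M : N = {x ∈ A | x N ⊆ M}` of two `R`-submodules of an `R`-algebra `A`,
as an `R`-submodule of `A`. -/
def colonSub {R A : Type*} [CommRing R] [CommRing A] [Algebra R A]
    (M N : Submodule R A) : Submodule R A where
  carrier := {x : A | ∀ y ∈ N, x * y ∈ M}
  add_mem' := fun {a b} ha hb y hy => by
    rw [add_mul]; exact M.add_mem (ha y hy) (hb y hy)
  zero_mem' := fun y hy => by rw [zero_mul]; exact M.zero_mem
  smul_mem' := fun c {x} hx y hy => by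
    rw [smul_mul_assoc]; exact M.smul_mem c (hx y hy)



section ExtComputation

variable {R : Type u} [CommRing R] {X : ModuleCat.{u} R} (P : ProjectiveResolution X)
  (Y : ModuleCat.{u} R)

lemma eq_zero_of_subsingleton_ext_zero (h : Subsingleton (extMod R X Y 0))
    (b : P.complex.X 0 ⟶ Y) (hb : P.complex.d 1 0 ≫ b = 0) : b = 0 := by
  have h1 : (P.complex.linearYonedaObj R Y).ExactAt 0 := by
    rw [HomologicalComplex.exactAt_iff_isZero_homology]
    exact (ModuleCat.isZero_of_subsingleton (extMod R X Y 0)).of_iso (P.isoExt 0 Y).symm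
  rw [HomologicalComplex.exactAt_iff' _ 0 0 1 (by simp) (by simp),
    ShortComplex.moduleCat_exact_iff] at h1
  obtain ⟨a, ha⟩ := h1 b hb
  rw [← ha]
  have : (P.complex.linearYonedaObj R Y).d 0 0 = 0 := HomologicalComplex.shape _ _ _ (by simp)
  exact congr($this a)

lemma exists_d_comp_eq_of_subsingleton_ext (n : ℕ) (h : Subsingleton (extMod R X Y (n + 1)))
    (b : P.complex.X (n + 1) ⟶ Y) (hb : P.complex.d (n + 2) (n + 1) ≫ b = 0) :
    ∃ a : P.complex.X n ⟶ Y, P.complex.d (n + 1) n ≫ a = b := by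
  have h1 : (P.complex.linearYonedaObj R Y).ExactAt (n + 1) := by
    rw [HomologicalComplex.exactAt_iff_isZero_homology]
    exact (ModuleCat.isZero_of_subsingleton (extMod R X Y (n + 1))).of_iso (P.isoExt (n + 1) Y).symm
  rw [HomologicalComplex.exactAt_iff' _ n (n + 1) (n + 2) (by simp) (by simp),
    ShortComplex.moduleCat_exact_iff] at h1
  exact h1 b hb

lemma exists_smul_add_smul_eq_d_comp (n : ℕ) {m : Ideal R} (hm : m ≠ ⊤)
    (e : extMod R X Y (n + 1) ≅ ModuleCat.of R (R ⧸ m))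
    (b b' : P.complex.X (n + 1) ⟶ Y) (hb : P.complex.d (n + 2) (n + 1) ≫ b = 0)
    (hb' : P.complex.d (n + 2) (n + 1) ≫ b' = 0) :
    ∃ r r' : R, (r ∉ m ∨ r' ∉ m) ∧
      ∃ a : P.complex.X n ⟶ Y, P.complex.d (n + 1) n ≫ a = r • b + r' • b' := by
  let Q := P.complex.linearYonedaObj R Y
  let S := Q.sc' n (n + 1) (n + 2)
  let i : S.moduleCatLeftHomologyData.H ≅ ModuleCat.of R (R ⧸ m) :=
    S.moduleCatHomologyIso.symm ≪≫
      ShortComplex.homologyMapIso (Q.isoSc' n (n + 1) (n + 2) (by simp) (by simp)).symm ≪≫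
      (P.isoExt (n + 1) Y).symm ≪≫ e
  let φ : (LinearMap.ker S.g.hom ⧸ LinearMap.range S.moduleCatToCycles) ≃ₗ[R] (R ⧸ m) :=
    i.toLinearEquiv
  let c : LinearMap.ker S.g.hom := ⟨b, hb⟩
  let c' : LinearMap.ker S.g.hom := ⟨b', hb'⟩
  obtain ⟨t, ht⟩ := Ideal.Quotient.mk_surjective (φ (Submodule.Quotient.mk c))
  obtain ⟨t', ht'⟩ := Ideal.Quotient.mk_surjective (φ (Submodule.Quotient.mk c'))
  have key : ∀ r r' : R, r * t + r' * t' ∈ m →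
      ∃ a : P.complex.X n ⟶ Y, P.complex.d (n + 1) n ≫ a = r • b + r' • b' := by
    intro r r' h
    have h1 : φ (Submodule.Quotient.mk (r • c + r' • c')) = 0 := by
      rw [Submodule.Quotient.mk_add, Submodule.Quotient.mk_smul, Submodule.Quotient.mk_smul,
        map_add, map_smul, map_smul, ← ht, ← ht']
      rw [← Ideal.Quotient.eq_zero_iff_mem] at h
      rw [← h, map_add, map_mul, map_mul]
      rfl
    rw [LinearEquiv.map_eq_zero_iff, Submodule.Quotient.mk_eq_zero] at h1
    obtain ⟨a, ha⟩ := h1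
    exact ⟨a, congrArg Subtype.val ha⟩
  have h1 : (1 : R) ∉ m := fun h => hm ((Ideal.eq_top_iff_one _).2 h)
  by_cases h : t ∈ m
  · exact ⟨1, 0, .inl h1, key 1 0 (by simpa using h)⟩
  · exact ⟨t', -t, .inr (by simpa using h), key _ _ (by simp [mul_comm])⟩

end ExtComputation
section CanonicalModule

variable {R : Type u} [CommRing R] {m : Ideal R} {K : Type u} [AddCommGroup K] [Module R K]

lemma IsCanonicalModuleAt.exists_resolution (hm : m ≠ ⊤) (hK : IsCanonicalModuleAt R m K) :
    ∃ (P₀ P₁ P₂ : ModuleCat.{u} R) (π : P₀ →ₗ[R] (R ⧸ m)) (d₁ : P₁ →ₗ[R] P₀) (d₂ : P₂ →ₗ[R] P₁),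
      Module.Projective R P₀ ∧ Module.Projective R P₁ ∧ Module.Projective R P₂ ∧
      Function.Surjective π ∧ Function.Exact d₁ π ∧ Function.Exact d₂ d₁ ∧
      (∀ b : P₀ →ₗ[R] K, b ∘ₗ d₁ = 0 → b = 0) ∧
      (∀ b b' : P₁ →ₗ[R] K, b ∘ₗ d₂ = 0 → b' ∘ₗ d₂ = 0 →
        ∃ r r' : R, (r ∉ m ∨ r' ∉ m) ∧ ∃ a : P₀ →ₗ[R] K, a ∘ₗ d₁ = r • b + r' • b') ∧
      (∀ b : P₂ →ₗ[R] K, (∀ z, d₂ z = 0 → b z = 0) → ∃ a : P₁ →ₗ[R] K, a ∘ₗ d₂ = b) := by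
  obtain ⟨-, hK0, ⟨e⟩⟩ := hK
  let P : ProjectiveResolution (ModuleCat.of R (R ⧸ m)) := ProjectiveResolution.of _
  let Y := ModuleCat.of R K
  have hP (n : ℕ) : Module.Projective R (P.complex.X n) :=
    (IsProjective.iff_projective (R := R) (P.complex.X n)).2 (P.projective n)
  have hd (n : ℕ) : Function.Exact (P.complex.d (n + 2) (n + 1)).hom
      (P.complex.d (n + 1) n).hom :=
    (ShortComplex.ShortExact.moduleCat_exact_iff_function_exact _).1 (P.exact_succ n)
  let π : P.complex.X 0 ⟶ ModuleCat.of R (R ⧸ m) := P.π.f 0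
  refine ⟨P.complex.X 0, P.complex.X 1, P.complex.X 2, π.hom, (P.complex.d 1 0).hom,
    (P.complex.d 2 1).hom, hP 0, hP 1, hP 2, ?_, ?_, hd 0, ?_, ?_, ?_⟩
  · exact (ModuleCat.epi_iff_surjective _).1 (inferInstanceAs (Epi (P.π.f 0)))
  · exact (ShortComplex.ShortExact.moduleCat_exact_iff_function_exact _).1 P.exact₀
  · intro b hb
    have := eq_zero_of_subsingleton_ext_zero P Y (hK0 0 (by simp)) (ModuleCat.ofHom b)
      (by ext z; exact congr($hb z))
    exact congr($(this).hom)
  · intro b b' hb hb'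
    obtain ⟨r, r', h, a, ha⟩ := exists_smul_add_smul_eq_d_comp P Y 0 hm e (ModuleCat.ofHom b)
      (ModuleCat.ofHom b') (by ext z; exact congr($hb z)) (by ext z; exact congr($hb' z))
    exact ⟨r, r', h, a.hom, congr($(ha).hom)⟩
  · intro b hb
    obtain ⟨a, ha⟩ := exists_d_comp_eq_of_subsingleton_ext P Y 1 (hK0 2 (by simp))
      (ModuleCat.ofHom b) (by
        ext z
        exact hb _ ((hd 1 _).2 ⟨z, rfl⟩))
    exact ⟨a.hom, congr($(ha).hom)⟩

end CanonicalModule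

section CanonicalModuleLocal

open IsLocalRing

variable {R : Type u} [CommRing R] [IsLocalRing R] {K : Type u} [AddCommGroup K] [Module R K]

lemma IsCanonicalModuleAt.eq_zero_of_forall_smul (hK : IsCanonicalModuleAt R (maximalIdeal R) K)
    (z : K) (hz : ∀ x ∈ maximalIdeal R, x • z = 0) : z = 0 := by
  obtain ⟨P₀, P₁, P₂, π, d₁, d₂, -, -, -, hπ, h1, -, h0, -, -⟩ :=
    hK.exists_resolution Ideal.IsPrime.ne_top'
  let ζ : (R ⧸ maximalIdeal R) →ₗ[R] K :=
    Submodule.liftQ _ (LinearMap.toSpanSingleton R K z) (fun x hx => by simpa using hz x hx)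
  have h2 := h0 (ζ ∘ₗ π) (by
    ext y
    simp [h1.apply_apply_eq_zero])
  obtain ⟨p, hp⟩ := hπ (Ideal.Quotient.mk _ 1)
  have h3 := congr($h2 p)
  simp only [LinearMap.comp_apply, hp, LinearMap.zero_apply] at h3
  have h4 : ζ (Submodule.Quotient.mk 1) = (1 : R) • z := rfl
  rw [one_smul] at h4
  exact h4.symm.trans h3

/-- A projective cover of the residue field compares with `R`. -/
lemma exists_comparison {P₀ : Type u} [AddCommGroup P₀] [Module R P₀] [Module.Projective R P₀]
    {π : P₀ →ₗ[R] (R ⧸ maximalIdeal R)} (hπ : Function.Surjective π) :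
    ∃ (ε : P₀ →ₗ[R] R) (p : P₀), (∀ y, π y = 0 → ε y ∈ maximalIdeal R) ∧
      (∀ x ∈ maximalIdeal R, π (x • p) = 0) ∧ ε p = 1 := by
  obtain ⟨ε, hε⟩ := Module.projective_lifting_property (Submodule.mkQ (maximalIdeal R)) π
    (Submodule.mkQ_surjective _)
  obtain ⟨p, hp⟩ := hπ (Ideal.Quotient.mk _ 1)
  have hε' (y : P₀) : Ideal.Quotient.mk (maximalIdeal R) (ε y) = π y := congr($hε y)
  have hu : IsUnit (ε p) := by
    by_contra h
    have : ε p ∈ maximalIdeal R := h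
    rw [← Ideal.Quotient.eq_zero_iff_mem, hε', hp, Ideal.Quotient.eq_zero_iff_mem] at this
    exact (Ideal.ne_top_iff_one _).1 Ideal.IsPrime.ne_top' this
  obtain ⟨u, hu⟩ := hu
  refine ⟨ε, (↑u⁻¹ : R) • p, fun y hy => ?_, fun x hx => ?_, ?_⟩
  · rw [← Ideal.Quotient.eq_zero_iff_mem, hε', hy]
  · rw [map_smul, map_smul, smul_comm, hp]
    have : x • (Ideal.Quotient.mk (maximalIdeal R) 1) = 0 := by
      rw [← Ideal.Quotient.eq_zero_iff_mem] at hx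
      rw [← hx, map_one]
      exact (Algebra.algebraMap_eq_smul_one (A := R ⧸ maximalIdeal R) x).symm
    rw [this, smul_zero]
  · simp [← hu]

lemma IsCanonicalModuleAt.exists_smul_add_smul
    (hK : IsCanonicalModuleAt R (maximalIdeal R) K) (g g' : maximalIdeal R →ₗ[R] K) :
    ∃ r r' : R, (r ∉ maximalIdeal R ∨ r' ∉ maximalIdeal R) ∧
      ∃ c : K, ∀ x : maximalIdeal R, r • g x + r' • g' x = (x : R) • c := by
  obtain ⟨P₀, P₁, P₂, π, d₁, d₂, _, -, -, hπ, h1, h2, -, hH, -⟩ :=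
    hK.exists_resolution Ideal.IsPrime.ne_top'
  obtain ⟨ε, p, hε, hp, hεp⟩ := exists_comparison hπ
  let δ : P₁ →ₗ[R] maximalIdeal R :=
    (ε ∘ₗ d₁).codRestrict _ (fun y => hε _ (h1.apply_apply_eq_zero y))
  have hδ : δ ∘ₗ d₂ = 0 := by
    ext y
    simp [δ, h2.apply_apply_eq_zero]
  obtain ⟨r, r', h, a, ha⟩ := hH (g ∘ₗ δ) (g' ∘ₗ δ)
    (by rw [LinearMap.comp_assoc, hδ, LinearMap.comp_zero])
    (by rw [LinearMap.comp_assoc, hδ, LinearMap.comp_zero])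
  refine ⟨r, r', h, a p, fun x => ?_⟩
  obtain ⟨y, hy⟩ := (h1 _).1 (hp x x.2)
  have h3 := congr($ha y)
  have h4 : δ y = x := Subtype.ext (by simp [δ, hy, hεp])
  simp only [LinearMap.comp_apply, LinearMap.add_apply, LinearMap.smul_apply, hy, h4,
    map_smul] at h3
  exact h3.symm

lemma IsCanonicalModuleAt.exists_lift
    (hK : IsCanonicalModuleAt R (maximalIdeal R) K) {f : R} (hf : ∀ z : K, f • z = 0 → z = 0)
    {E : Type*} [AddCommGroup E] [Module R E] (q : K →ₗ[R] E) (hq : Function.Surjective q)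
    (hqf : ∀ z, q z = 0 ↔ ∃ w, z = f • w) (g : maximalIdeal R →ₗ[R] E) :
    ∃ g' : maximalIdeal R →ₗ[R] K, q ∘ₗ g' = g := by
  obtain ⟨P₀, P₁, P₂, π, d₁, d₂, _, _, _, hπ, h1, h2, -, -, hH⟩ :=
    hK.exists_resolution Ideal.IsPrime.ne_top'
  obtain ⟨ε, p, hε, hp, hεp⟩ := exists_comparison hπ
  let δ : P₁ →ₗ[R] maximalIdeal R :=
    (ε ∘ₗ d₁).codRestrict _ (fun y => hε _ (h1.apply_apply_eq_zero y))
  have hδ (y : P₂) : δ (d₂ y) = 0 := Subtype.ext (by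
    change ε (d₁ (d₂ y)) = 0
    rw [h2.apply_apply_eq_zero, map_zero])
  obtain ⟨α, hα⟩ := Module.projective_lifting_property q (g ∘ₗ δ) hq
  have hα' (y : P₁) : q (α y) = g (δ y) := congr($hα y)
  have hinj : Function.Injective (LinearMap.lsmul R K f) :=
    (injective_iff_map_eq_zero _).2 (fun z hz => hf z hz)
  have hrange (y : P₂) : (α ∘ₗ d₂) y ∈ LinearMap.range (LinearMap.lsmul R K f) := by
    obtain ⟨w, hw⟩ := (hqf (α (d₂ y))).1 (by rw [hα', hδ, map_zero])
    exact ⟨w, hw.symm⟩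
  let β : P₂ →ₗ[R] K := (LinearEquiv.ofInjective _ hinj).symm ∘ₗ (α ∘ₗ d₂).codRestrict _ hrange
  have hβ (y : P₂) : f • β y = α (d₂ y) :=
    congr_arg Subtype.val ((LinearEquiv.ofInjective _ hinj).apply_symm_apply ⟨_, hrange y⟩)
  obtain ⟨α', hα''⟩ := hH β (fun z hz => hf _ (by rw [hβ, hz, map_zero]))
  let ψ : P₁ →ₗ[R] K := α - f • α'
  have hψ (y : P₁) (hy : d₁ y = 0) : ψ y = 0 := by
    obtain ⟨z, rfl⟩ := (h2 y).1 hy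
    have : α' (d₂ z) = β z := congr($hα'' z)
    simp [ψ, this, hβ]
  let κ : LinearMap.range d₁ →ₗ[R] K :=
    (LinearMap.ker d₁).liftQ ψ (fun y hy => hψ y hy) ∘ₗ d₁.quotKerEquivRange.symm
  have hκ (y : P₁) : κ ⟨d₁ y, y, rfl⟩ = ψ y := by
    have : d₁.quotKerEquivRange.symm ⟨d₁ y, y, rfl⟩ = Submodule.Quotient.mk y := by
      rw [LinearEquiv.symm_apply_eq]
      rfl
    change Submodule.liftQ _ ψ (fun y hy => hψ y hy) (d₁.quotKerEquivRange.symm ⟨d₁ y, y, rfl⟩) = ψ y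
    rw [this]
    rfl
  let θ : maximalIdeal R →ₗ[R] LinearMap.range d₁ :=
    ((LinearMap.toSpanSingleton R P₀ p) ∘ₗ (maximalIdeal R).subtype).codRestrict _
      (fun x => (h1 _).1 (hp x x.2))
  refine ⟨κ ∘ₗ θ, ?_⟩
  ext x
  obtain ⟨y, hy⟩ := (h1 _).1 (hp x x.2)
  have h4 : δ y = x := Subtype.ext (by simp [δ, hy, hεp])
  have h5 : θ x = ⟨d₁ y, y, rfl⟩ := Subtype.ext (show (x : R) • p = d₁ y from hy.symm)
  have h6 : q (f • α' y) = 0 := (hqf _).2 ⟨_, rfl⟩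
  simp only [LinearMap.comp_apply, h5, hκ]
  simp only [ψ, LinearMap.sub_apply, LinearMap.smul_apply, map_sub, h6, sub_zero, hα', h4]

end CanonicalModuleLocal

section LengthLemmas

open IsLocalRing

variable {R : Type*} [CommRing R]

lemma LinearMap.exists_smul_eq_of_forall_exists {M K : Type*} [AddCommGroup M] [Module R M]
    [AddCommGroup K] [Module R K] {f : R} (hf : ∀ z : K, f • z = 0 → z = 0) (φ : M →ₗ[R] K)
    (h : ∀ x, ∃ w, f • w = φ x) : ∃ ψ : M →ₗ[R] K, ∀ x, f • ψ x = φ x := by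
  have hinj : Function.Injective (LinearMap.lsmul R K f) :=
    (injective_iff_map_eq_zero _).2 (fun z hz => hf z hz)
  refine ⟨(LinearEquiv.ofInjective _ hinj).symm ∘ₗ
    φ.codRestrict (LinearMap.range (LinearMap.lsmul R K f)) h, fun x => ?_⟩
  exact congr_arg Subtype.val ((LinearEquiv.ofInjective _ hinj).apply_symm_apply ⟨_, h x⟩)

lemma QuotSMulTop.mk_eq_zero {M : Type*} [AddCommGroup M] [Module R M] (c : R) (x : M) :
    (Submodule.Quotient.mk x : QuotSMulTop c M) = 0 ↔ ∃ y, c • y = x := by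
  rw [Submodule.Quotient.mk_eq_zero, Submodule.mem_smul_pointwise_iff_exists]
  simp

lemma QuotSMulTop.smul_eq_zero {M : Type*} [AddCommGroup M] [Module R M] (c : R)
    (x : QuotSMulTop c M) : c • x = 0 := by
  obtain ⟨x, rfl⟩ := Submodule.Quotient.mk_surjective _ x
  exact (QuotSMulTop.mk_eq_zero c _).2 ⟨x, rfl⟩

/-- The quotient map onto `M / c M`. -/
def QuotSMulTop.proj (c : R) (M : Type*) [AddCommGroup M] [Module R M] : M →ₗ[R] QuotSMulTop c M :=
  Submodule.mkQ _

lemma QuotSMulTop.proj_eq_zero {M : Type*} [AddCommGroup M] [Module R M] (c : R) (x : M) :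
    QuotSMulTop.proj c M x = 0 ↔ ∃ y, c • y = x :=
  QuotSMulTop.mk_eq_zero c x

lemma QuotSMulTop.proj_surjective {M : Type*} [AddCommGroup M] [Module R M] (c : R) :
    Function.Surjective (QuotSMulTop.proj c M) :=
  Submodule.mkQ_surjective _

lemma QuotSMulTop.exists_comp_proj_eq {M N : Type*} [AddCommGroup M] [Module R M]
    [AddCommGroup N] [Module R N] (c : R) (f : M →ₗ[R] N) (hf : ∀ x, c • f x = 0) :
    ∃ g : QuotSMulTop c M →ₗ[R] N, ∀ x, g (QuotSMulTop.proj c M x) = f x :=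
  ⟨Submodule.liftQ _ f (fun x hx => by
    obtain ⟨y, rfl⟩ := (QuotSMulTop.mk_eq_zero c x).1 ((Submodule.Quotient.mk_eq_zero _).2 hx)
    rw [LinearMap.mem_ker, map_smul, hf]), fun _ => rfl⟩

lemma LinearMap.surjective_of_length_le {M N : Type*} [AddCommGroup M] [Module R M]
    [AddCommGroup N] [Module R N] (f : M →ₗ[R] N) (hf : Function.Injective f)
    (hM : IsFiniteLength R M) (h : Module.length R N ≤ Module.length R M) :
    Function.Surjective f := by
  have h1 := Module.length_eq_add_of_exact f (LinearMap.range f).mkQ hf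
    (Submodule.mkQ_surjective _) (LinearMap.exact_map_mkQ_range f)
  rw [← Module.length_ne_top_iff] at hM
  rw [h1] at h
  have h2 : Module.length R (N ⧸ LinearMap.range f) = 0 := by
    by_contra h0
    exact absurd h (not_le.2 ((ENat.add_one_le_iff hM).1
      (add_le_add_right (Order.one_le_iff_ne_zero.2 h0) _)))
  rw [Module.length_eq_zero_iff, Submodule.Quotient.subsingleton_iff] at h2
  exact LinearMap.range_eq_top.1 h2

variable [IsLocalRing R]

lemma length_le_one_of_forall_exists_smul_add_smul {M : Type*} [AddCommGroup M] [Module R M]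
    (h : ∀ x y : M, ∃ r s : R, (r ∉ maximalIdeal R ∨ s ∉ maximalIdeal R) ∧ r • x + s • y = 0)
    (hM : ∀ x ∈ maximalIdeal R, ∀ y : M, x • y = 0) : Module.length R M ≤ 1 := by
  rcases subsingleton_or_nontrivial M with _ | _
  · simp [Module.length_eq_zero]
  have hu {r : R} (hr : r ∉ maximalIdeal R) : IsUnit r := by simpa using hr
  have : IsSimpleModule R M := by
    rw [isSimpleModule_iff]
    refine ⟨fun N => or_iff_not_imp_left.2 fun hN => ?_⟩
    obtain ⟨x, hx, hx0⟩ := N.ne_bot_iff.1 hN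
    refine eq_top_iff.2 fun y _ => ?_
    obtain ⟨r, s, hrs, he⟩ := h x y
    by_cases hs : s ∈ maximalIdeal R
    · have hr := hrs.resolve_right (not_not.2 hs)
      rw [hM s hs, add_zero] at he
      exact absurd ((hu hr).smul_eq_zero.1 he) hx0
    · rw [← Submodule.smul_mem_iff_of_isUnit N (hu hs)]
      rw [eq_neg_of_add_eq_zero_right he]
      exact N.neg_mem (N.smul_mem _ hx)
  rw [Module.length_eq_one]

lemma IsSimpleModule.exists_forall_eq_smul (M : Type*) [AddCommGroup M] [Module R M]
    [IsSimpleModule R M] : ∃ x : M, (∀ y, ∃ r : R, y = r • x) ∧ ∀ a ∈ maximalIdeal R, a • x = 0 := by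
  obtain ⟨J, hJ, ⟨e⟩⟩ := isSimpleModule_iff_quot_maximal.1 ‹IsSimpleModule R M›
  obtain rfl := eq_maximalIdeal hJ
  refine ⟨e.symm (Ideal.Quotient.mk _ 1), fun y => ?_, fun a ha => ?_⟩
  · obtain ⟨r, hr⟩ := Ideal.Quotient.mk_surjective (e y)
    refine ⟨r, ?_⟩
    rw [← map_smul, LinearEquiv.eq_symm_apply, ← hr, ← mul_one r, map_mul, mul_one]
    rfl
  · rw [← map_smul]
    have : a • (Ideal.Quotient.mk (maximalIdeal R) 1) = 0 := by
      rw [← Ideal.Quotient.eq_zero_iff_mem] at ha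
      rw [← ha, map_one]
      exact (Algebra.algebraMap_eq_smul_one (A := R ⧸ maximalIdeal R) a).symm
    rw [this, map_zero]

lemma length_linearMap_le {E : Type*} [AddCommGroup E] [Module R E]
    (hE : ∀ x y : E, (∀ a ∈ maximalIdeal R, a • x = 0) → (∀ a ∈ maximalIdeal R, a • y = 0) →
      ∃ r s : R, (r ∉ maximalIdeal R ∨ s ∉ maximalIdeal R) ∧ r • x + s • y = 0)
    {X : Type*} [AddCommGroup X] [Module R X] (hX : IsFiniteLength R X) :
    Module.length R (X →ₗ[R] E) ≤ Module.length R X := by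
  induction hX with
  | of_subsingleton =>
    rw [Module.length_eq_zero_iff.2]
    · simp
    · exact ⟨fun a b => LinearMap.ext fun x => by rw [Subsingleton.elim x 0, map_zero, map_zero]⟩
  | @of_simple_quotient X _ _ N hS hN ih =>
    let res : (X →ₗ[R] E) →ₗ[R] (N →ₗ[R] E) := LinearMap.lcomp R E N.subtype
    let ι : ((X ⧸ N) →ₗ[R] E) →ₗ[R] (X →ₗ[R] E) := LinearMap.lcomp R E N.mkQ
    have hι : Function.Injective ι := fun a b hab => by
      ext x
      exact congr($hab x)
    have h1 := Module.length_eq_add_of_exact ι res.rangeRestrict hι res.surjective_rangeRestrict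
      (fun g => by
        constructor
        · intro hg
          have hg' : res g = 0 := congr_arg Subtype.val hg
          refine ⟨N.liftQ g (fun x hx => congr($hg' ⟨x, hx⟩)), ?_⟩
          ext x
          rfl
        · rintro ⟨g, rfl⟩
          refine Subtype.ext (LinearMap.ext fun x => ?_)
          change g (N.mkQ x) = 0
          rw [Submodule.mkQ_apply, (Submodule.Quotient.mk_eq_zero N).2 x.2, map_zero])
    have h2 := Module.length_le_of_injective (LinearMap.range res).subtype
      (Submodule.injective_subtype _)
    have h3 : Module.length R ((X ⧸ N) →ₗ[R] E) ≤ 1 := by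
      obtain ⟨x, hx, hxa⟩ := IsSimpleModule.exists_forall_eq_smul (R := R) (X ⧸ N)
      refine length_le_one_of_forall_exists_smul_add_smul (fun g g' => ?_) (fun a ha g => ?_)
      · obtain ⟨r, s, hrs, h⟩ := hE (g x) (g' x) (fun a ha => by rw [← map_smul, hxa a ha, map_zero])
          (fun a ha => by rw [← map_smul, hxa a ha, map_zero])
        refine ⟨r, s, hrs, LinearMap.ext fun y => ?_⟩
        obtain ⟨t, rfl⟩ := hx y
        rw [map_smul, LinearMap.add_apply, LinearMap.smul_apply, LinearMap.smul_apply, h,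
          smul_zero, LinearMap.zero_apply]
      · ext y
        obtain ⟨t, ht⟩ := hx (N.mkQ y)
        change a • g (N.mkQ y) = 0
        rw [ht, ← map_smul, smul_comm, hxa a ha, smul_zero, map_zero]
    have h4 := Module.length_eq_add_of_exact N.subtype N.mkQ N.injective_subtype N.mkQ_surjective
      (LinearMap.exact_subtype_mkQ N)
    rw [h1, h4, Module.length_eq_one (R := R) (M := X ⧸ N), add_comm]
    exact add_le_add (h2.trans ih) h3

lemma exists_ne_zero_forall_smul_eq_zero {M : Type*} [AddCommGroup M] [Module R M] (n : ℕ)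
    (z : M) (hz : z ≠ 0) (h : ∀ x ∈ maximalIdeal R ^ n, x • z = 0) :
    ∃ y : M, y ≠ 0 ∧ (∃ r : R, y = r • z) ∧ ∀ x ∈ maximalIdeal R, x • y = 0 := by
  induction n generalizing z with
  | zero => exact absurd (by simpa using h 1 (by simp)) hz
  | succ n ih =>
    by_cases h0 : ∀ x ∈ maximalIdeal R, x • z = 0
    · exact ⟨z, hz, ⟨1, by simp⟩, h0⟩
    push Not at h0
    obtain ⟨x, hx, hxz⟩ := h0
    obtain ⟨y, hy, ⟨r, hr⟩, hy'⟩ := ih (x • z) hxz (fun a ha => by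
      rw [← mul_smul]
      exact h _ (by rw [pow_succ]; exact Ideal.mul_mem_mul ha hx))
    exact ⟨y, hy, ⟨r * x, by rw [hr, mul_smul]⟩, hy'⟩

end LengthLemmas

section Duality

open IsLocalRing nonZeroDivisors Pointwise

variable {R : Type u} [CommRing R] [IsLocalRing R] [IsNoetherianRing R] [Ring.KrullDimLE 1 R]
  {K : Type u} [AddCommGroup K] [Module R K]

lemma exists_maximalIdeal_pow_le_span_singleton {c : R} (hc : c ∈ R⁰) :
    ∃ n, maximalIdeal R ^ n ≤ Ideal.span {c} := by
  have h := isFiniteLength_quotient_span_singleton R hc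
  have : IsArtinianRing (R ⧸ Ideal.span {c}) := by
    have := (isFiniteLength_iff_isNoetherian_isArtinian.1 h).2
    exact isArtinian_of_tower R this
  exact exists_maximalIdeal_pow_le_of_isArtinianRing_quotient _

lemma isTorsionBySet_span_singleton {R M : Type*} [CommRing R] [AddCommGroup M] [Module R M] {c : R}
    (hM : ∀ x : M, c • x = 0) : Module.IsTorsionBySet R M (Ideal.span {c} : Ideal R) := by
  rintro x ⟨a, ha⟩
  obtain ⟨b, rfl⟩ := Ideal.mem_span_singleton'.1 ha
  change (b * c) • x = 0
  rw [mul_smul, hM, smul_zero]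

namespace IsCanonicalModuleAt

variable (hK : IsCanonicalModuleAt R (maximalIdeal R) K)

include hK

lemma eq_zero_of_smul_eq_zero {c : R} (hc : c ∈ R⁰) (z : K) (hz : c • z = 0) : z = 0 := by
  obtain ⟨n, hn⟩ := exists_maximalIdeal_pow_le_span_singleton hc
  by_contra h0
  obtain ⟨y, hy, -, hy'⟩ := exists_ne_zero_forall_smul_eq_zero n z h0 (fun x hx => by
    obtain ⟨a, rfl⟩ := Ideal.mem_span_singleton'.1 (hn hx)
    rw [mul_smul, hz, smul_zero])
  exact hy (hK.eq_zero_of_forall_smul y hy')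

lemma exists_smul_add_smul_eq_zero {c : R} (hc : c ∈ R⁰) (x y : QuotSMulTop c K)
    (hx : ∀ a ∈ maximalIdeal R, a • x = 0) (hy : ∀ a ∈ maximalIdeal R, a • y = 0) :
    ∃ r s : R, (r ∉ maximalIdeal R ∨ s ∉ maximalIdeal R) ∧ r • x + s • y = 0 := by
  have key (z : K) (hz : ∀ a ∈ maximalIdeal R, a • (Submodule.Quotient.mk z : QuotSMulTop c K) = 0) :
      ∃ g : maximalIdeal R →ₗ[R] K, ∀ a, c • g a = (a : R) • z :=
    LinearMap.exists_smul_eq_of_forall_exists (hK.eq_zero_of_smul_eq_zero hc)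
      (LinearMap.toSpanSingleton R K z ∘ₗ (maximalIdeal R).subtype)
      (fun a => (QuotSMulTop.mk_eq_zero c _).1 (hz a a.2))
  obtain ⟨x, rfl⟩ := Submodule.Quotient.mk_surjective _ x
  obtain ⟨y, rfl⟩ := Submodule.Quotient.mk_surjective _ y
  obtain ⟨g, hg⟩ := key x hx
  obtain ⟨g', hg'⟩ := key y hy
  obtain ⟨r, s, hrs, w, hw⟩ := hK.exists_smul_add_smul g g'
  refine ⟨r, s, hrs, (QuotSMulTop.mk_eq_zero c _).2 ⟨w, ?_⟩⟩
  rw [← sub_eq_zero]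
  refine hK.eq_zero_of_forall_smul _ fun a ha => ?_
  have h1 := congr_arg (c • ·) (hw ⟨a, ha⟩)
  simp only [smul_add, smul_comm c, hg, hg'] at h1
  rw [smul_sub, smul_add, smul_comm a r, smul_comm a s, h1]
  simp [smul_comm a c]

lemma length_linearMap_le {c : R} (hc : c ∈ R⁰) {X : Type*} [AddCommGroup X] [Module R X]
    (hX : IsFiniteLength R X) : Module.length R (X →ₗ[R] QuotSMulTop c K) ≤ Module.length R X :=
  _root_.length_linearMap_le (hK.exists_smul_add_smul_eq_zero hc) hX

lemma exists_eq_smul_of_maximalIdeal {c : R} (hc : c ∈ R⁰) (hcm : c ∈ maximalIdeal R)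
    (φ : maximalIdeal R →ₗ[R] QuotSMulTop c K) (hφ : φ ⟨c, hcm⟩ = 0) :
    ∃ z : QuotSMulTop c K, ∀ x, φ x = (x : R) • z := by
  obtain ⟨ψ, hψ⟩ := hK.exists_lift (hK.eq_zero_of_smul_eq_zero hc)
    (c • (⊤ : Submodule R K)).mkQ (Submodule.mkQ_surjective _)
    (fun z => by simpa [eq_comm] using QuotSMulTop.mk_eq_zero c z) φ
  have hψ' (x : maximalIdeal R) : (Submodule.Quotient.mk (ψ x) : QuotSMulTop c K) = φ x :=
    congr($hψ x)
  obtain ⟨z, hz⟩ := (QuotSMulTop.mk_eq_zero c _).1 ((hψ' ⟨c, hcm⟩).trans hφ)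
  refine ⟨Submodule.Quotient.mk z, fun x => ?_⟩
  have : ψ x = (x : R) • z := by
    rw [← sub_eq_zero]
    apply hK.eq_zero_of_smul_eq_zero hc
    rw [smul_sub, smul_comm c, hz, ← map_smul, ← map_smul, sub_eq_zero]
    exact congr_arg ψ (Subtype.ext (mul_comm _ _))
  rw [← hψ', this]
  rfl

lemma exists_eq_smul {c : R} (hc : c ∈ R⁰) (hcm : c ∈ maximalIdeal R) (I : Ideal R) (hcI : c ∈ I)
    (φ : I →ₗ[R] QuotSMulTop c K) (hφ : φ ⟨c, hcI⟩ = 0) :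
    ∃ z : QuotSMulTop c K, ∀ x, φ x = (x : R) • z := by
  induction I using IsNoetherian.induction with
  | hgt I ih =>
  by_cases hI : I = ⊤
  · subst hI
    refine ⟨φ ⟨1, trivial⟩, fun x => ?_⟩
    rw [← map_smul]
    exact congr_arg φ (Subtype.ext (mul_one _).symm)
  have hIm : I ≤ maximalIdeal R := le_maximalIdeal hI
  obtain ⟨n, hn⟩ := exists_maximalIdeal_pow_le_span_singleton hc
  obtain ⟨y', hy0, -, hy⟩ := exists_ne_zero_forall_smul_eq_zero n (M := R ⧸ I)
    (Ideal.Quotient.mk I 1) (fun h => hI ((Ideal.eq_top_iff_one _).2 (Ideal.Quotient.eq_zero_iff_mem.1 h)))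
    (fun x hx => by
      obtain ⟨a, rfl⟩ := Ideal.mem_span_singleton'.1 (hn hx)
      refine (Submodule.Quotient.mk_eq_zero I).2 ?_
      change a * c * 1 ∈ I
      rw [mul_one]
      exact Ideal.mul_mem_left I _ hcI)
  obtain ⟨y, rfl⟩ := Ideal.Quotient.mk_surjective y'
  have hyI : y ∉ I := fun h => hy0 (Ideal.Quotient.eq_zero_iff_mem.2 h)
  have hmy (x : R) (hx : x ∈ maximalIdeal R) : x * y ∈ I :=
    (Submodule.Quotient.mk_eq_zero I).1 (hy x hx)
  obtain ⟨z, hz⟩ := hK.exists_eq_smul_of_maximalIdeal hc hcm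
    (φ ∘ₗ (LinearMap.toSpanSingleton R R y ∘ₗ (maximalIdeal R).subtype).codRestrict I
      (fun x => hmy x x.2)) (by
      have : φ (y • ⟨c, hcI⟩) = 0 := by rw [map_smul, hφ, smul_zero]
      rw [← this]
      exact congr_arg φ (Subtype.ext (mul_comm _ _)))
  have hz' (x : R) (hx : x ∈ maximalIdeal R) : φ ⟨x * y, hmy x hx⟩ = x • z := hz ⟨x, hx⟩
  have hry (r : R) (hr : r • y ∈ I) : r ∈ maximalIdeal R := by
    by_contra h
    have hu : IsUnit r := by simpa using h
    exact hyI ((Submodule.smul_mem_iff_of_isUnit I hu).1 hr)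
  let F : R →ₗ.[R] QuotSMulTop c K := ⟨I, φ⟩
  let G : R →ₗ.[R] QuotSMulTop c K := LinearPMap.mkSpanSingleton' y z (fun r hr => by
    have hrm := hry r (hr ▸ I.zero_mem)
    have : φ ⟨r * y, hmy r hrm⟩ = φ 0 := congr_arg φ (Subtype.ext hr)
    rw [RingHom.id_apply, ← hz' r hrm, this, map_zero])
  have hFG : ∀ (a : F.domain) (b : G.domain), (a : R) = b → F a = G b := by
    rintro ⟨a, ha⟩ ⟨b, hb⟩ (rfl : a = b)
    obtain ⟨r, rfl⟩ := Submodule.mem_span_singleton.1 hb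
    have hrm := hry r ha
    refine (hz' r hrm).trans ?_
    exact (LinearPMap.mkSpanSingleton'_apply y z _ r hb).symm
  let H := F.sup G hFG
  have hFH : F ≤ H := LinearPMap.left_le_sup F G hFG
  have hyH : y ∈ H.domain := Submodule.mem_sup_right (Submodule.mem_span_singleton_self y)
  have hlt : I < H.domain := lt_of_le_of_ne hFH.1 (fun h => hyI (h ▸ hyH))
  have hH (x : I) : H.toFun ⟨x, hFH.1 x.2⟩ = φ x := (hFH.2 (x := x) rfl).symm
  obtain ⟨w, hw⟩ := ih H.domain hlt (hFH.1 hcI) H.toFun ((hH ⟨c, hcI⟩).trans hφ)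
  exact ⟨w, fun x => by rw [← hH, hw]⟩

lemma baer {c : R} (hc : c ∈ R⁰) (hcm : c ∈ maximalIdeal R)
    [Module (R ⧸ Ideal.span {c}) (QuotSMulTop c K)]
    [IsScalarTower R (R ⧸ Ideal.span {c}) (QuotSMulTop c K)] :
    Module.Baer (R ⧸ Ideal.span {c}) (QuotSMulTop c K) := by
  intro J g
  let π := Ideal.Quotient.mk (Ideal.span {c})
  have hc0 : π c = 0 := Ideal.Quotient.eq_zero_iff_mem.2 (Ideal.mem_span_singleton_self c)
  let φ : J.comap π →ₗ[R] QuotSMulTop c K :=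
    { toFun := fun x => g ⟨π x, x.2⟩
      map_add' := fun x y => by
        rw [← map_add]
        exact congr_arg g (Subtype.ext (map_add π _ _))
      map_smul' := fun a x => by
        rw [RingHom.id_apply, ← algebraMap_smul (R ⧸ Ideal.span {c}) a (g _), ← map_smul]
        exact congr_arg g (Subtype.ext (map_mul π _ _)) }
  obtain ⟨z, hz⟩ := hK.exists_eq_smul hc hcm (J.comap π) (by simp [hc0]) φ (by
    rw [← map_zero g]
    exact congr_arg g (Subtype.ext hc0))
  refine ⟨LinearMap.toSpanSingleton _ _ z, fun x hx => ?_⟩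
  obtain ⟨x, rfl⟩ := Ideal.Quotient.mk_surjective x
  rw [LinearMap.toSpanSingleton_apply]
  exact (algebraMap_smul (R ⧸ Ideal.span {c}) x z).trans (hz ⟨x, hx⟩).symm

lemma exists_comp_eq {c : R} (hc : c ∈ R⁰) (hcm : c ∈ maximalIdeal R) {X Y : Type*}
    [AddCommGroup X] [Module R X] [AddCommGroup Y] [Module R Y] (hX : ∀ x : X, c • x = 0)
    (i : Y →ₗ[R] X) (g : Y →ₗ[R] QuotSMulTop c K) (hi : ∀ y, i y = 0 → g y = 0) :
    ∃ h : X →ₗ[R] QuotSMulTop c K, h ∘ₗ i = g := by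
  have tX := isTorsionBySet_span_singleton hX
  have tN := isTorsionBySet_span_singleton (c := c) (M := LinearMap.range i) (fun x => Subtype.ext (hX x))
  have tE := isTorsionBySet_span_singleton (QuotSMulTop.smul_eq_zero (M := K) c)
  let _ := tX.module
  let _ := tN.module
  let _ := tE.module
  have := tX.isScalarTower (S := R)
  have := tN.isScalarTower (S := R)
  have := tE.isScalarTower (S := R)
  have hinj := (hK.baer hc hcm).injective
  let g' : LinearMap.range i →ₗ[R] QuotSMulTop c K :=
    (LinearMap.ker i).liftQ g hi ∘ₗ i.quotKerEquivRange.symm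
  obtain ⟨h, hh⟩ := Module.Injective.extension_property (R ⧸ Ideal.span {c}) (QuotSMulTop c K) _ _
    (LinearMap.extendScalarsOfSurjective (R := R) Ideal.Quotient.mk_surjective
      (LinearMap.range i).subtype) (Submodule.injective_subtype _)
    (LinearMap.extendScalarsOfSurjective (R := R) Ideal.Quotient.mk_surjective g')
  refine ⟨h.restrictScalars R, LinearMap.ext fun y => ?_⟩
  have h1 := congr($hh ⟨i y, y, rfl⟩)
  have h2 : i.quotKerEquivRange.symm ⟨i y, y, rfl⟩ = Submodule.Quotient.mk y := by
    rw [LinearEquiv.symm_apply_eq]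
    rfl
  have h3 : g' ⟨i y, y, rfl⟩ = g y := by
    change (LinearMap.ker i).liftQ g hi (i.quotKerEquivRange.symm ⟨i y, y, rfl⟩) = g y
    rw [h2]
    rfl
  exact h1.trans h3

end IsCanonicalModuleAt

end Duality

/-- The socle of a module over a local ring. -/
abbrev localSocle (R M : Type*) [CommRing R] [IsLocalRing R] [AddCommGroup M] [Module R M] :
    Submodule R M :=
  Submodule.torsionBySet R M (IsLocalRing.maximalIdeal R)

lemma mem_localSocle {R M : Type*} [CommRing R] [IsLocalRing R] [AddCommGroup M] [Module R M]
    {x : M} : x ∈ localSocle R M ↔ ∀ a ∈ IsLocalRing.maximalIdeal R, a • x = 0 := by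
  simp [Submodule.mem_torsionBySet_iff]

lemma isFiniteLength_of_forall_smul_eq_zero {R : Type*} [CommRing R] {c : R}
    (hc : IsFiniteLength R (R ⧸ Ideal.span {c})) {M : Type*} [AddCommGroup M] [Module R M]
    [Module.Finite R M] (hM : ∀ x : M, c • x = 0) : IsFiniteLength R M := by
  obtain ⟨n, f, hf⟩ := Module.Finite.exists_fin' R M
  have h1 : IsFiniteLength R (Fin n → R ⧸ Ideal.span {c}) := by
    rw [isFiniteLength_iff_isNoetherian_isArtinian] at hc ⊢
    obtain ⟨_, _⟩ := hc
    exact ⟨inferInstance, inferInstance⟩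
  let g (i : Fin n) : (R ⧸ Ideal.span {c}) →ₗ[R] M :=
    Submodule.liftQ _ (f ∘ₗ LinearMap.single R (fun _ => R) i) (fun a ha => by
      obtain ⟨b, rfl⟩ := Ideal.mem_span_singleton'.1 ha
      rw [LinearMap.mem_ker, mul_comm, ← smul_eq_mul, map_smul, hM])
  refine h1.of_surjective (f := LinearMap.lsum R (fun _ => R ⧸ Ideal.span {c}) R g) (fun y => ?_)
  obtain ⟨x, rfl⟩ := hf y
  refine ⟨fun i => Ideal.Quotient.mk _ (x i), ?_⟩
  rw [LinearMap.lsum_apply, LinearMap.sum_apply]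
  have (i : Fin n) : (g i ∘ₗ LinearMap.proj i) (fun i => Ideal.Quotient.mk _ (x i)) =
    f (Pi.single i (x i)) := rfl
  simp only [this]
  rw [← map_sum, Finset.univ_sum_single]

section Duality

open IsLocalRing nonZeroDivisors Pointwise

variable {R : Type u} [CommRing R] [IsLocalRing R] [IsNoetherianRing R] [Ring.KrullDimLE 1 R]
  {K : Type u} [AddCommGroup K] [Module R K]

namespace IsCanonicalModuleAt

variable (hK : IsCanonicalModuleAt R (maximalIdeal R) K)

include hK

lemma exists_apply_ne_zero [Nontrivial K] {c : R} (hc : c ∈ R⁰) (hcm : c ∈ maximalIdeal R)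
    {X : Type*} [AddCommGroup X] [Module R X] (hX : ∀ x : X, c • x = 0) (x : X) (hx : x ≠ 0) :
    ∃ g : X →ₗ[R] QuotSMulTop c K, g x ≠ 0 := by
  have := hK.1
  have : Nontrivial (QuotSMulTop c K) := by
    by_contra h
    rw [not_nontrivial_iff_subsingleton, Submodule.Quotient.subsingleton_iff] at h
    refine absurd (Submodule.eq_bot_of_le_smul_of_le_jacobson_bot (Ideal.span {c})
      (⊤ : Submodule R K) Module.Finite.fg_top (by rw [Submodule.ideal_span_singleton_smul, h]) ?_)
      top_ne_bot
    rw [IsLocalRing.jacobson_eq_maximalIdeal ⊥ bot_ne_top, Ideal.span_singleton_le_iff_mem]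
    exact hcm
  obtain ⟨z, hz⟩ := exists_ne (0 : QuotSMulTop c K)
  obtain ⟨n, hn⟩ := exists_maximalIdeal_pow_le_span_singleton hc
  obtain ⟨e, he0, -, he⟩ := exists_ne_zero_forall_smul_eq_zero n z hz (fun a ha => by
    obtain ⟨b, rfl⟩ := Ideal.mem_span_singleton'.1 (hn ha)
    rw [mul_smul, QuotSMulTop.smul_eq_zero, smul_zero])
  obtain ⟨h, hh⟩ := hK.exists_comp_eq hc hcm hX (LinearMap.toSpanSingleton R X x)
    (LinearMap.toSpanSingleton R _ e) (fun r hr => by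
      refine he r ?_
      by_contra h
      have hu : IsUnit r := by simpa using h
      exact hx (hu.smul_eq_zero.1 hr))
  refine ⟨h, fun h0 => he0 ?_⟩
  have h1 := congr($hh 1)
  simpa [h0] using h1.symm

lemma isFiniteLength_quotSMulTop {c : R} (hc : c ∈ R⁰) :
    IsFiniteLength R (QuotSMulTop c K) := by
  have := hK.1
  exact isFiniteLength_of_forall_smul_eq_zero (isFiniteLength_quotient_span_singleton R hc)
    (QuotSMulTop.smul_eq_zero c)

lemma exists_eq_smul_of_end [Nontrivial K] {c : R} (hc : c ∈ R⁰) (hcm : c ∈ maximalIdeal R)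
    (φ : QuotSMulTop c K →ₗ[R] QuotSMulTop c K) : ∃ a : R, ∀ x, φ x = a • x := by
  have hfin := isFiniteLength_quotient_span_singleton R hc
  let θ : (R ⧸ Ideal.span {c}) →ₗ[R] (QuotSMulTop c K →ₗ[R] QuotSMulTop c K) :=
    Submodule.liftQ _ (LinearMap.lsmul R _) (fun a ha => by
      obtain ⟨b, rfl⟩ := Ideal.mem_span_singleton'.1 ha
      refine LinearMap.ext fun x => ?_
      change (b * c) • x = 0
      rw [mul_smul, QuotSMulTop.smul_eq_zero, smul_zero])
  have hθ (a : R) (x : QuotSMulTop c K) : θ (Ideal.Quotient.mk _ a) x = a • x := rfl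
  have hquot : ∀ x : R ⧸ Ideal.span {c}, c • x = 0 := fun x => by
    obtain ⟨x, rfl⟩ := Ideal.Quotient.mk_surjective x
    exact Ideal.Quotient.eq_zero_iff_mem.2 (Ideal.mul_mem_right x _ (Ideal.mem_span_singleton_self c))
  have hinj : Function.Injective θ := by
    rw [injective_iff_map_eq_zero]
    intro a ha
    by_contra h0
    obtain ⟨g, hg⟩ := hK.exists_apply_ne_zero hc hcm hquot a h0
    obtain ⟨a, rfl⟩ := Ideal.Quotient.mk_surjective a
    apply hg
    have h1 : g (a • Ideal.Quotient.mk (Ideal.span {c}) 1) = 0 := by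
      rw [map_smul, ← hθ, ha, LinearMap.zero_apply]
    rw [← h1]
    congr 1
    exact congr_arg (Ideal.Quotient.mk (Ideal.span {c})) (mul_one a).symm
  have h1 : Module.length R (QuotSMulTop c K) ≤ Module.length R (R ⧸ Ideal.span {c}) := by
    refine le_trans ?_ (hK.length_linearMap_le hc hfin)
    let ι : QuotSMulTop c K →ₗ[R] ((R ⧸ Ideal.span {c}) →ₗ[R] QuotSMulTop c K) := θ.flip
    refine Module.length_le_of_injective ι (fun x y hxy => ?_)
    have := congr($hxy (Ideal.Quotient.mk _ 1))
    have h2 : (1 : R) • x = (1 : R) • y := this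
    rwa [one_smul, one_smul] at h2
  obtain ⟨a, ha⟩ := LinearMap.surjective_of_length_le θ hinj hfin
    ((hK.length_linearMap_le hc (hK.isFiniteLength_quotSMulTop hc)).trans h1) φ
  obtain ⟨a, rfl⟩ := Ideal.Quotient.mk_surjective a
  exact ⟨a, fun x => by rw [← ha, hθ]⟩

lemma exists_lift_ideal {c : R} (hc : c ∈ R⁰) (hcm : c ∈ maximalIdeal R) {I : Ideal R}
    {a : R} (ha : a ∈ R⁰) (haI : a ∈ I) (g : I →ₗ[R] QuotSMulTop c K) :
    ∃ w : I →ₗ[R] K, ∀ x, QuotSMulTop.proj c K (w x) = g x := by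
  have hac : c * a ∈ R⁰ := mul_mem hc ha
  obtain ⟨μ, hμ⟩ := QuotSMulTop.exists_comp_proj_eq c
    (QuotSMulTop.proj (c * a) K ∘ₗ LinearMap.lsmul R K a) (fun x => by
      rw [← map_smul]
      exact (QuotSMulTop.proj_eq_zero _ _).2 ⟨x, by simp [mul_smul, smul_comm c a]⟩)
  simp only [LinearMap.comp_apply, LinearMap.lsmul_apply] at hμ
  obtain ⟨z, hz⟩ := hK.exists_eq_smul hac (Ideal.mul_mem_right _ _ hcm) I (I.mul_mem_left c haI)
    (μ ∘ₗ g) (by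
      have : (⟨c * a, I.mul_mem_left c haI⟩ : I) = c • ⟨a, haI⟩ := rfl
      rw [LinearMap.comp_apply, this, map_smul, QuotSMulTop.smul_eq_zero, map_zero])
  obtain ⟨z, rfl⟩ := QuotSMulTop.proj_surjective _ z
  have key (x : I) (k : K) (hk : QuotSMulTop.proj c K k = g x) :
      ∃ y, a • (k - c • y) = (x : R) • z := by
    have h1 := hz x
    rw [LinearMap.comp_apply, ← hk, hμ, ← map_smul, ← sub_eq_zero, ← map_sub] at h1
    obtain ⟨y, hy⟩ := (QuotSMulTop.proj_eq_zero _ _).1 h1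
    refine ⟨y, ?_⟩
    rw [smul_sub, ← mul_smul, mul_comm a c, hy, sub_sub_cancel]
  obtain ⟨w, hw⟩ := LinearMap.exists_smul_eq_of_forall_exists (hK.eq_zero_of_smul_eq_zero ha)
    (LinearMap.toSpanSingleton R K z ∘ₗ I.subtype) (fun x => by
      obtain ⟨k, hk⟩ := QuotSMulTop.proj_surjective _ (g x)
      obtain ⟨y, hy⟩ := key x k hk
      exact ⟨_, hy⟩)
  refine ⟨w, fun x => ?_⟩
  obtain ⟨k, hk⟩ := QuotSMulTop.proj_surjective _ (g x)
  obtain ⟨y, hy⟩ := key x k hk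
  have h1 : w x = k - c • y := by
    rw [← sub_eq_zero]
    apply hK.eq_zero_of_smul_eq_zero ha
    rw [smul_sub, hy, sub_eq_zero]
    exact hw x
  rw [h1, ← hk, ← sub_eq_zero, ← map_sub]
  exact (QuotSMulTop.proj_eq_zero _ _).2 ⟨-y, by simp⟩

end IsCanonicalModuleAt

end Duality

section MinGen

open IsLocalRing

variable {R : Type*} [CommRing R] {M : Type*} [AddCommGroup M] [Module R M]

lemma minGen_le_spanFinrank {N : Submodule R M} (hN : N.FG) : minGen R N ≤ N.spanFinrank := by
  refine Nat.sInf_le ⟨hN.finite_generators.toFinset, ?_, ?_⟩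
  · rw [← Set.ncard_eq_toFinset_card _ hN.finite_generators, hN.generators_ncard]
  · rw [Set.Finite.coe_toFinset, Submodule.span_generators]

lemma minGen_le_length [IsLocalRing R] {N : Submodule R M} (hN : N.FG) :
    (minGen R N : ℕ∞) ≤ Module.length R (N ⧸ maximalIdeal R • (⊤ : Submodule R N)) := by
  have : Module.Finite R N := Module.Finite.of_fg hN
  have h1 := minGen_le_spanFinrank hN
  rw [spanFinrank_eq_finrank_quotient N hN] at h1
  let _ : Field (R ⧸ maximalIdeal R) := Ideal.Quotient.field _
  have h3 : Module.Finite (R ⧸ maximalIdeal R) (N ⧸ maximalIdeal R • (⊤ : Submodule R N)) :=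
    Module.Finite.of_restrictScalars_finite R _ _
  rw [Module.length_eq_of_surjective (S := R) (R := R ⧸ maximalIdeal R) Ideal.Quotient.mk_surjective,
    Module.length_eq_finrank]
  exact_mod_cast h1

end MinGen

section Duality

open IsLocalRing nonZeroDivisors Pointwise

lemma QuotSMulTop.map_proj {R M N : Type*} [CommRing R] [AddCommGroup M] [Module R M]
    [AddCommGroup N] [Module R N] (c : R) (g : M →ₗ[R] N) (x : M) :
    QuotSMulTop.map c g (QuotSMulTop.proj c M x) = QuotSMulTop.proj c N (g x) :=
  rfl

variable {R : Type u} [CommRing R] [IsLocalRing R] [IsNoetherianRing R] [Ring.KrullDimLE 1 R]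
  {K : Type u} [AddCommGroup K] [Module R K]

namespace IsCanonicalModuleAt

variable (hK : IsCanonicalModuleAt R (maximalIdeal R) K)

include hK

lemma exists_eq_smul_proj [Nontrivial K] {c : R} (hc : c ∈ R⁰) (hcm : c ∈ maximalIdeal R)
    {I : Ideal R} {a : R} (ha : a ∈ R⁰) (haI : a ∈ I) (ht : Function.Bijective (evalMap R I K))
    (φ : I →ₗ[R] QuotSMulTop c I) : ∃ b : R, φ = b • QuotSMulTop.proj c I := by
  let B : I →ₗ[R] (I →ₗ[R] K) →ₗ[R] QuotSMulTop c K :=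
    LinearMap.mk₂ R (fun x g => QuotSMulTop.map c g (φ x))
      (fun x y g => by rw [map_add, map_add])
      (fun r x g => by rw [map_smul, map_smul])
      (fun x g g' => by
        obtain ⟨y, hy⟩ := QuotSMulTop.proj_surjective c (φ x)
        simp only [← hy, QuotSMulTop.map_proj, LinearMap.add_apply, map_add])
      (fun r x g => by
        obtain ⟨y, hy⟩ := QuotSMulTop.proj_surjective c (φ x)
        simp only [← hy, QuotSMulTop.map_proj, LinearMap.smul_apply, map_smul])
  let h : K →ₗ[R] QuotSMulTop c K :=
    TensorProduct.lift B ∘ₗ (LinearEquiv.ofBijective _ ht).symm.toLinearMap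
  have hh (x : I) (g : I →ₗ[R] K) : h (g x) = QuotSMulTop.map c g (φ x) := by
    have : (LinearEquiv.ofBijective _ ht).symm (g x) = x ⊗ₜ[R] g := by
      rw [LinearEquiv.symm_apply_eq]
      rfl
    change TensorProduct.lift B ((LinearEquiv.ofBijective _ ht).symm (g x)) = _
    rw [this]
    rfl
  obtain ⟨h', hh'⟩ := QuotSMulTop.exists_comp_proj_eq c h
    (fun x => QuotSMulTop.smul_eq_zero c _)
  obtain ⟨b, hb⟩ := hK.exists_eq_smul_of_end hc hcm h'
  refine ⟨b, LinearMap.ext fun x => ?_⟩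
  rw [LinearMap.smul_apply, ← sub_eq_zero]
  by_contra h0
  obtain ⟨G, hG⟩ := hK.exists_apply_ne_zero hc hcm (QuotSMulTop.smul_eq_zero c) _ h0
  obtain ⟨w, hw⟩ := hK.exists_lift_ideal hc hcm ha haI (G ∘ₗ QuotSMulTop.proj c I)
  have hGw (y : QuotSMulTop c I) : G y = QuotSMulTop.map c w y := by
    obtain ⟨y, rfl⟩ := QuotSMulTop.proj_surjective c y
    rw [QuotSMulTop.map_proj, hw, LinearMap.comp_apply]
  apply hG
  rw [hGw, map_sub, ← hh, map_smul, QuotSMulTop.map_proj, ← hh', hb, sub_self]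

lemma minGen_le_length_localSocle {c : R} (hc : c ∈ R⁰) (hcm : c ∈ maximalIdeal R)
    {I : Ideal R} {a : R} (ha : a ∈ R⁰) (haI : a ∈ I) :
    (minGen R (⊤ : Submodule R (I →ₗ[R] K)) : ℕ∞) ≤
      Module.length R (localSocle R (QuotSMulTop c I)) := by
  have := hK.1
  have hfin : IsFiniteLength R (localSocle R (QuotSMulTop c I)) :=
    (isFiniteLength_of_forall_smul_eq_zero (isFiniteLength_quotient_span_singleton R hc)
      (QuotSMulTop.smul_eq_zero c)).of_injective (f := Submodule.subtype _)
      (Submodule.injective_subtype _)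
  let ρ : (I →ₗ[R] K) →ₗ[R] (localSocle R (QuotSMulTop c I) →ₗ[R] QuotSMulTop c K) :=
    { toFun := fun g => QuotSMulTop.map c g ∘ₗ (localSocle R (QuotSMulTop c I)).subtype
      map_add' := fun g g' => by
        ext ⟨x, hx⟩
        obtain ⟨x, rfl⟩ := QuotSMulTop.proj_surjective c x
        change QuotSMulTop.proj c K (g x + g' x) = _
        rw [map_add]
        rfl
      map_smul' := fun r g => by
        ext ⟨x, hx⟩
        obtain ⟨x, rfl⟩ := QuotSMulTop.proj_surjective c x
        change QuotSMulTop.proj c K (r • g x) = _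
        rw [map_smul]
        rfl }
  classical
  have hker : LinearMap.ker ρ ≤ maximalIdeal R • (⊤ : Submodule R (I →ₗ[R] K)) := by
    intro g hg
    obtain ⟨S, hS⟩ := (isNoetherian_def.1 (inferInstanceAs (IsNoetherian R R))) (maximalIdeal R)
    let T : QuotSMulTop c I →ₗ[R] (S → QuotSMulTop c I) :=
      LinearMap.pi fun t => LinearMap.lsmul R _ (t : R)
    obtain ⟨G, hG⟩ := hK.exists_comp_eq hc hcm (X := S → QuotSMulTop c I)
      (fun x => funext fun t => QuotSMulTop.smul_eq_zero c _) T (QuotSMulTop.map c g) (fun y hy => by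
        have hy' : y ∈ localSocle R (QuotSMulTop c I) := by
          rw [mem_localSocle]
          have hle : maximalIdeal R ≤ LinearMap.ker (LinearMap.toSpanSingleton R _ y) := by
            rw [← hS, Submodule.span_le]
            intro t ht
            exact congr_fun hy ⟨t, ht⟩
          exact fun a ha => hle ha
        exact congr($hg ⟨y, hy'⟩))
    choose w hw using fun t : S => hK.exists_lift_ideal hc hcm ha haI
      (G ∘ₗ LinearMap.single R _ t ∘ₗ QuotSMulTop.proj c I)
    obtain ⟨v, hv⟩ := LinearMap.exists_smul_eq_of_forall_exists (hK.eq_zero_of_smul_eq_zero hc)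
      (g - ∑ t : S, (t : R) • w t) (fun x => by
        rw [← QuotSMulTop.proj_eq_zero, LinearMap.sub_apply, map_sub, sub_eq_zero,
          ← QuotSMulTop.map_proj, ← hG, LinearMap.sum_apply, map_sum, LinearMap.comp_apply]
        conv_lhs => rw [← Finset.univ_sum_single (T (QuotSMulTop.proj c I x)), map_sum]
        refine Finset.sum_congr rfl fun t _ => ?_
        rw [LinearMap.smul_apply, map_smul, hw]
        simp only [LinearMap.comp_apply]
        rw [← map_smul, ← map_smul]
        rfl)
    have : g = c • v + ∑ t : S, (t : R) • w t := by
      rw [← sub_eq_iff_eq_add]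
      exact LinearMap.ext fun x => (hv x).symm
    rw [this]
    refine add_mem (Submodule.smul_mem_smul hcm trivial) (sum_mem fun t _ => ?_)
    refine Submodule.smul_mem_smul ?_ trivial
    rw [← hS]
    exact Submodule.subset_span t.2
  let V := I →ₗ[R] K
  have h1 : (minGen R (⊤ : Submodule R V) : ℕ∞) ≤
      Module.length R ((⊤ : Submodule R V) ⧸ maximalIdeal R • (⊤ : Submodule R (⊤ : Submodule R V))) :=
    minGen_le_length Module.Finite.fg_top
  have h2 : Module.length R
      ((⊤ : Submodule R V) ⧸ maximalIdeal R • (⊤ : Submodule R (⊤ : Submodule R V))) ≤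
      Module.length R (LinearMap.range ρ) := by
    refine le_of_le_of_eq ?_ ρ.quotKerEquivRange.length_eq
    let f : V →ₗ[R]
        ((⊤ : Submodule R V) ⧸ maximalIdeal R • (⊤ : Submodule R (⊤ : Submodule R V))) :=
      Submodule.mkQ _ ∘ₗ Submodule.topEquiv.symm.toLinearMap
    have hf : LinearMap.ker ρ ≤ LinearMap.ker f := by
      refine hker.trans (Submodule.smul_le.2 fun r hr g _ => ?_)
      refine (Submodule.Quotient.mk_eq_zero _).2 ?_
      change Submodule.topEquiv.symm (r • g) ∈ _
      rw [map_smul]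
      exact Submodule.smul_mem_smul hr trivial
    refine Module.length_le_of_surjective ((LinearMap.ker ρ).liftQ f hf) (fun y => ?_)
    obtain ⟨⟨y, hy⟩, rfl⟩ := Submodule.Quotient.mk_surjective _ y
    exact ⟨Submodule.Quotient.mk y, rfl⟩
  exact (h1.trans h2).trans ((Module.length_le_of_injective _ (Submodule.injective_subtype _)).trans
    (hK.length_linearMap_le hc hfin))

end IsCanonicalModuleAt

end Duality

section Counting

open IsLocalRing

lemma LinearMap.injective_of_length_le {R : Type*} [CommRing R] {M N : Type*} [AddCommGroup M]
    [Module R M] [AddCommGroup N] [Module R N] (f : M →ₗ[R] N) (hf : Function.Surjective f)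
    (hN : IsFiniteLength R N) (h : Module.length R M ≤ Module.length R N) :
    Function.Injective f := by
  have h1 := Module.length_eq_add_of_exact (LinearMap.ker f).subtype f
    (Submodule.injective_subtype _) hf (LinearMap.exact_subtype_ker_map f)
  rw [← Module.length_ne_top_iff] at hN
  rw [h1, add_comm] at h
  have h2 : Module.length R (LinearMap.ker f) = 0 := by
    by_contra h0
    exact absurd h (not_le.2 ((ENat.add_one_le_iff hN).1
      (add_le_add_right (Order.one_le_iff_ne_zero.2 h0) _)))
  rw [Module.length_eq_zero_iff, Submodule.subsingleton_iff_eq_bot] at h2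
  exact LinearMap.ker_eq_bot.1 h2

variable {S : Type*} [CommRing S] [IsLocalRing S] {M : Type*} [AddCommGroup M] [Module S M]

/-- A minimal generating family and the maps into the socle it defines. -/
lemma exists_minimal_generators [Module.Finite S M] :
    ∃ (n : ℕ) (x : Fin n → M),
      Module.length S (M ⧸ maximalIdeal S • (⊤ : Submodule S M)) = n ∧
      Submodule.span S (Set.range x) = ⊤ ∧
      ∀ y : Fin n → localSocle S M, ∃ φ : M →ₗ[S] localSocle S M, ∀ i, φ (x i) = y i := by
  let _ : Field (S ⧸ maximalIdeal S) := Ideal.Quotient.field _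
  let V := M ⧸ maximalIdeal S • (⊤ : Submodule S M)
  have hfin : Module.Finite (S ⧸ maximalIdeal S) V := Module.Finite.of_restrictScalars_finite S _ _
  let b := Module.finBasis (S ⧸ maximalIdeal S) V
  choose x hx using fun i => Submodule.mkQ_surjective (maximalIdeal S • (⊤ : Submodule S M)) (b i)
  refine ⟨_, x, ?_, ?_, fun y => ?_⟩
  · rw [Module.length_eq_of_surjective (S := S) (R := S ⧸ maximalIdeal S)
      Ideal.Quotient.mk_surjective, Module.length_eq_finrank]
  · refine eq_top_iff.2 (Submodule.le_of_le_smul_of_le_jacobson_bot (I := maximalIdeal S)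
      Module.Finite.fg_top (IsLocalRing.maximalIdeal_le_jacobson _) ?_)
    rw [top_le_iff, sup_comm, ← Submodule.map_mkQ_eq_top, Submodule.map_span, ← Set.range_comp]
    have h1 : (Submodule.mkQ (maximalIdeal S • (⊤ : Submodule S M)) ∘ x) = b := funext hx
    rw [h1, eq_top_iff]
    rintro v -
    have h2 : v ∈ Submodule.span (S ⧸ maximalIdeal S) (Set.range b) := by
      rw [b.span_eq]
      trivial
    rw [← Submodule.restrictScalars_mem S, Submodule.restrictScalars_span] at h2
    · exact h2
    · exact Ideal.Quotient.mk_surjective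
  · let ψ := b.constr (S ⧸ maximalIdeal S) y
    refine ⟨ψ.restrictScalars S ∘ₗ Submodule.mkQ _, fun i => ?_⟩
    rw [LinearMap.comp_apply, hx]
    exact b.constr_basis (S ⧸ maximalIdeal S) y i

theorem lt_length_quotient_of_forall_end_eq_smul [IsNoetherianRing S] {f : S}
    (hM : IsFiniteLength S M)
    (hfM : ∀ x : M, f • x = 0) (hend : ∀ φ : M →ₗ[S] M, ∃ a : S, ∀ x, φ x = a • x)
    (hle : Module.length S (S ⧸ Ideal.span {f}) ≤ Module.length S M) {r s : ℕ} (hr : 2 ≤ r)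
    (hs : 2 ≤ s) (hrM : (r : ℕ∞) ≤ Module.length S (M ⧸ maximalIdeal S • (⊤ : Submodule S M)))
    (hsM : (s : ℕ∞) ≤ Module.length S (localSocle S M)) :
    (((r + 1) * s : ℕ) : ℕ∞) < Module.length S (S ⧸ Ideal.span {f}) := by
  have hNA := isFiniteLength_iff_isNoetherian_isArtinian.1 hM
  have := hNA.1
  obtain ⟨ρ, x, hρ, hx, hext⟩ := exists_minimal_generators (S := S) (M := M)
  let Soc := localSocle S M
  have hSocFin : IsFiniteLength S Soc :=
    hM.of_injective (f := Soc.subtype) Soc.injective_subtype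
  obtain ⟨σ, hσ⟩ := ENat.ne_top_iff_exists.1 (Module.length_ne_top_iff.2 hSocFin)
  rw [hρ] at hrM
  rw [show Module.length S (localSocle S M) = σ from hσ.symm] at hsM
  have hrρ : r ≤ ρ := by exact_mod_cast hrM
  have hsσ : s ≤ σ := by exact_mod_cast hsM
  let J : Ideal S := (maximalIdeal S • (⊤ : Submodule S M)).annihilator
  have hJ {a : S} : a ∈ J ↔ ∀ t ∈ maximalIdeal S, ∀ x : M, a • t • x = 0 := by
    rw [Submodule.mem_annihilator]
    refine ⟨fun h t ht x => h _ (Submodule.smul_mem_smul ht trivial), fun h y hy => ?_⟩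
    induction hy using Submodule.smul_induction_on' with
    | smul t ht x _ => exact h t ht x
    | add y _ y' _ h1 h2 => rw [smul_add, h1, h2, add_zero]
  have hJSoc {a : S} (ha : a ∈ J) (x : M) : a • x ∈ Soc :=
    mem_localSocle.2 fun t ht => by rw [smul_comm, hJ.1 ha t ht]
  have hfJ : f ∈ J := hJ.2 fun t _ x => hfM _
  have hfJ' : Ideal.span {f} ≤ J := (Ideal.span_singleton_le_iff_mem _).2 hfJ
  let pr : (S ⧸ Ideal.span {f}) →ₗ[S] (S ⧸ J) := Submodule.mapQ _ _ LinearMap.id hfJ'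
  have hpr : Function.Surjective pr := fun a => by
    obtain ⟨a, rfl⟩ := Submodule.Quotient.mk_surjective _ a
    exact ⟨Submodule.Quotient.mk a, rfl⟩
  have hSf := Module.length_eq_add_of_exact (LinearMap.ker pr).subtype pr
    (Submodule.injective_subtype _) hpr (LinearMap.exact_subtype_ker_map pr)
  let ev : (S ⧸ Ideal.span {f}) →ₗ[S] (Fin ρ → M) :=
    Submodule.liftQ _ (LinearMap.toSpanSingleton S _ x) (fun a ha => by
      obtain ⟨b, rfl⟩ := Ideal.mem_span_singleton'.1 ha
      refine funext fun i => ?_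
      change (b * f) • x i = 0
      rw [mul_smul, hfM, smul_zero])
  have hev : ∀ z ∈ LinearMap.ker pr, ∀ i, ev z i ∈ Soc := by
    intro z hz i
    obtain ⟨a, rfl⟩ := Submodule.Quotient.mk_surjective _ z
    exact hJSoc ((Submodule.Quotient.mk_eq_zero J).1 hz) (x i)
  let ev' : LinearMap.ker pr →ₗ[S] (Fin ρ → Soc) :=
    LinearMap.pi fun i => (LinearMap.proj i ∘ₗ ev ∘ₗ (LinearMap.ker pr).subtype).codRestrict Soc
      fun z => hev z z.2 i
  have hev' : Function.Surjective ev' := fun y => by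
    obtain ⟨φ, hφ⟩ := hext y
    obtain ⟨a, ha⟩ := hend (Soc.subtype ∘ₗ φ)
    have haJ : a ∈ J := hJ.2 fun t ht z => by
      rw [← ha, LinearMap.comp_apply, map_smul, map_smul]
      exact mem_localSocle.1 (φ z).2 t ht
    refine ⟨⟨Submodule.Quotient.mk a, (Submodule.Quotient.mk_eq_zero J).2 haJ⟩,
      funext fun i => Subtype.ext ?_⟩
    change a • x i = y i
    rw [← ha, LinearMap.comp_apply, hφ]
    rfl
  have h1 : ((ρ * σ : ℕ) : ℕ∞) ≤ Module.length S (LinearMap.ker pr) := by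
    refine le_trans ?_ (Module.length_le_of_surjective ev' hev')
    rw [Module.length_pi_of_fintype, ← hσ]
    simp
  let gen : (Fin ρ → S ⧸ J) →ₗ[S] (M ⧸ Soc) :=
    LinearMap.lsum S (fun _ => S ⧸ J) S fun i =>
      Submodule.mapQ J Soc (LinearMap.toSpanSingleton S M (x i)) (fun a ha => hJSoc ha _)
  have hgen (a : Fin ρ → S) : gen (fun i => Submodule.Quotient.mk (a i)) =
      Submodule.Quotient.mk (∑ i, a i • x i) := by
    change LinearMap.lsum S (fun _ => S ⧸ J) S _ _ = Soc.mkQ _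
    rw [LinearMap.lsum_apply, LinearMap.sum_apply, map_sum]
    rfl
  have hgen_surj : Function.Surjective gen := fun y => by
    obtain ⟨y, rfl⟩ := Submodule.Quotient.mk_surjective _ y
    have hy : y ∈ Submodule.span S (Set.range x) := hx ▸ trivial
    obtain ⟨a, rfl⟩ := (Submodule.mem_span_range_iff_exists_fun S).1 hy
    exact ⟨_, hgen a⟩
  have hMSoc := Module.length_eq_add_of_exact Soc.subtype Soc.mkQ Soc.injective_subtype
    Soc.mkQ_surjective (LinearMap.exact_subtype_mkQ Soc)
  have hgen_le := Module.length_le_of_surjective gen hgen_surj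
  rw [Module.length_pi_of_fintype] at hgen_le
  have hMfin := Module.length_ne_top_iff.2 hM
  have hSffin : Module.length S (S ⧸ Ideal.span {f}) ≠ ⊤ := ne_top_of_le_ne_top hMfin hle
  have hAfin : Module.length S (S ⧸ J) ≠ ⊤ :=
    ne_top_of_le_ne_top hSffin (Module.length_le_of_surjective pr hpr)
  have hMSfin : Module.length S (M ⧸ Soc) ≠ ⊤ :=
    ne_top_of_le_ne_top hMfin (Module.length_le_of_surjective _ Soc.mkQ_surjective)
  have hkfin : Module.length S (LinearMap.ker pr) ≠ ⊤ :=
    ne_top_of_le_ne_top hSffin (Module.length_le_of_injective _ (Submodule.injective_subtype _))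
  obtain ⟨α, hα⟩ := ENat.ne_top_iff_exists.1 hAfin
  obtain ⟨κ, hκ⟩ := ENat.ne_top_iff_exists.1 hkfin
  obtain ⟨τ, hτ⟩ := ENat.ne_top_iff_exists.1 hMSfin
  rw [hSf, ← hκ, ← hα] at hle ⊢
  rw [hMSoc, ← hτ, ← hσ] at hle
  rw [← hκ] at h1
  rw [← hτ, ← hα] at hgen_le
  simp only [Finset.sum_const, Finset.card_univ, Fintype.card_fin, nsmul_eq_mul] at hgen_le
  norm_cast at hle h1 hgen_le ⊢
  have hασ : σ ≤ α := by nlinarith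
  have hne : α ≠ σ := by
    rintro rfl
    have hτ' : ρ * α ≤ τ := by omega
    have hgen_inj : Function.Injective gen := by
      refine LinearMap.injective_of_length_le gen hgen_surj (Module.length_ne_top_iff.1 hMSfin) ?_
      rw [Module.length_pi_of_fintype, ← hα, ← hτ]
      simp only [Finset.sum_const, Finset.card_univ, Fintype.card_fin, nsmul_eq_mul]
      exact_mod_cast hτ'
    let e := LinearEquiv.ofBijective gen ⟨hgen_inj, hgen_surj⟩
    let i₀ : Fin ρ := ⟨0, by omega⟩
    let i₁ : Fin ρ := ⟨1, by omega⟩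
    have hi : i₁ ≠ i₀ := by simp [i₀, i₁]
    have he (i : Fin ρ) : e (Pi.single i (Submodule.Quotient.mk 1)) = Submodule.Quotient.mk (x i) := by
      have := hgen (Pi.single i 1)
      have h2 : (fun j => Submodule.Quotient.mk ((Pi.single i 1 : Fin ρ → S) j) : Fin ρ → S ⧸ J) =
          Pi.single i (Submodule.Quotient.mk 1) := by
        ext j
        by_cases hj : j = i
        · subst hj; simp
        · simp [hj]
      rw [h2] at this
      refine this.trans ?_
      simp [Pi.single_apply]
    have hnSoc : ∀ y ∈ maximalIdeal S • (⊤ : Submodule S M), y ∈ Soc := by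
      intro y hy
      let μ : (S ⧸ J) →ₗ[S] M := Submodule.liftQ J (LinearMap.toSpanSingleton S M y)
        (fun a ha => Submodule.mem_annihilator.1 ha y hy)
      obtain ⟨a, ha⟩ := hend (μ ∘ₗ LinearMap.proj i₀ ∘ₗ e.symm.toLinearMap ∘ₗ Soc.mkQ)
      have h2 (i : Fin ρ) : a • x i =
          μ ((Pi.single i (Submodule.Quotient.mk 1) : Fin ρ → S ⧸ J) i₀) := by
        rw [← ha]
        change μ (e.symm (Submodule.Quotient.mk (x i)) i₀) = _
        rw [← he, LinearEquiv.symm_apply_apply]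
      have h3 : a • x i₁ = 0 := by
        rw [h2, Pi.single_eq_of_ne hi.symm, map_zero]
      have h4 : a • x i₀ = y := by
        rw [h2, Pi.single_eq_same]
        exact one_smul S y
      have h5 : a • (Pi.single i₁ (Submodule.Quotient.mk 1) : Fin ρ → S ⧸ J) = 0 := by
        apply e.injective
        rw [map_smul, he, ← Submodule.Quotient.mk_smul, h3, map_zero, Submodule.Quotient.mk_zero]
      have h6 : a ∈ J := by
        have := congr_fun h5 i₁
        rw [Pi.smul_apply, Pi.single_eq_same, ← Submodule.Quotient.mk_smul, smul_eq_mul,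
          mul_one] at this
        exact (Submodule.Quotient.mk_eq_zero J).1 this
      rw [← h4]
      exact hJSoc h6 _
    have hnJ : maximalIdeal S ≤ J := fun t ht => hJ.2 fun u hu z =>
      mem_localSocle.1 (hnSoc _ (Submodule.smul_mem_smul hu trivial)) t ht
    have h7 : Module.length S (S ⧸ J) ≤ Module.length S (S ⧸ maximalIdeal S) :=
      Module.length_le_of_surjective (Submodule.mapQ _ _ LinearMap.id hnJ) (fun a => by
        obtain ⟨a, rfl⟩ := Submodule.Quotient.mk_surjective _ a
        exact ⟨Submodule.Quotient.mk a, rfl⟩)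
    have : IsSimpleModule S (S ⧸ maximalIdeal S) :=
      isSimpleModule_iff_quot_maximal.2 ⟨_, inferInstance, ⟨LinearEquiv.refl _ _⟩⟩
    rw [Module.length_eq_one S (S ⧸ maximalIdeal S), ← hα] at h7
    have h8 : α ≤ 1 := by exact_mod_cast h7
    omega
  have : σ + 1 ≤ α := by omega
  calc (r + 1) * s ≤ (ρ + 1) * σ := by gcongr
    _ < κ + α := by linarith

end Counting

section Reduction

open IsLocalRing Polynomial

lemma exists_mem_forall_notMem {S : Type*} [CommRing S] [IsLocalRing S]
    [Infinite (ResidueField S)] {M : Type*} [AddCommGroup M] [Module S M] (N : Submodule S M)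
    (T : Finset (Submodule S M)) (hT : ∀ J ∈ T, ¬ N ≤ J) : ∃ x ∈ N, ∀ J ∈ T, x ∉ J := by
  classical
  induction T using Finset.induction with
  | empty => exact ⟨0, N.zero_mem, by simp⟩
  | insert J T _ ih =>
    obtain ⟨x, hxN, hx⟩ := ih fun J hJ => hT J (Finset.mem_insert_of_mem hJ)
    obtain ⟨y, hyN, hy⟩ := SetLike.not_le_iff_exists.1 (hT J (Finset.mem_insert_self _ _))
    by_contra! h
    choose σ hσ using residue_surjective (R := S)
    choose τ hτ hτ' using fun a : ResidueField S =>
      h (x + σ a • y) (N.add_mem hxN (N.smul_mem _ hyN))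
    obtain ⟨a, b, hab, he⟩ := Finite.exists_ne_map_eq_of_infinite
      (fun a => (⟨τ a, hτ a⟩ : {P // P ∈ insert J T}))
    have he' : τ a = τ b := congr_arg Subtype.val he
    have hb := hτ' b
    rw [← he'] at hb
    have hu : IsUnit (σ a - σ b) := by
      rw [← residue_ne_zero_iff_isUnit, map_sub, hσ, hσ]
      exact sub_ne_zero.2 hab
    have hy' : y ∈ τ a := by
      have := (τ a).sub_mem (hτ' a) hb
      rw [add_sub_add_left_eq_sub, ← sub_smul] at this
      exact ((τ a).smul_mem_iff_of_isUnit hu).1 this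
    rcases Finset.mem_insert.1 (hτ a) with h1 | h1
    · exact hy (h1 ▸ hy')
    · exact hx _ h1 (((τ a).add_mem_iff_left ((τ a).smul_mem _ hy')).1 (hτ' a))

variable {S : Type*} [CommRing S]

/-- The inclusion of `I ^ k` as the degree `k` part of the Rees algebra of `I`. -/
def reesMonomial (I : Ideal S) (k : ℕ) : ↥(I ^ k) →ₗ[S] reesAlgebra I :=
  ((Polynomial.monomial k).comp (I ^ k).subtype).codRestrict (Subalgebra.toSubmodule (reesAlgebra I))
    fun x => reesAlgebra.monomial_mem.2 x.2

lemma coe_reesMonomial (I : Ideal S) (k : ℕ) (x : ↥(I ^ k)) :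
    (reesMonomial I k x : S[X]) = Polynomial.monomial k (x : S) := rfl

lemma reesMonomial_mul {I : Ideal S} {j k : ℕ} (x : ↥(I ^ j)) (y : ↥(I ^ k)) (z : ↥(I ^ (j + k)))
    (h : (z : S) = x * y) :
    reesMonomial I (j + k) z = reesMonomial I j x * reesMonomial I k y := by
  refine Subtype.ext ?_
  rw [coe_reesMonomial, h, ← monomial_mul_monomial]
  rfl

/-- An ideal of the Rees algebra containing `fT` and all of degree `k` contains all of degree `k+1`. -/
lemma exists_mul_reesMonomial_eq [IsLocalRing S] {c : ℕ}
    (h : ∀ k, Module.length S (↥(maximalIdeal S ^ k) ⧸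
      maximalIdeal S • (⊤ : Submodule S ↥(maximalIdeal S ^ k))) ≤ c)
    (P : Ideal (reesAlgebra (maximalIdeal S))) [P.IsPrime]
    (hP : ∀ a ∈ maximalIdeal S, algebraMap S _ a ∈ P) {u : ↥(maximalIdeal S ^ 1)}
    (hu : reesMonomial _ 1 u ∉ P) :
    ∃ k, ∀ x : ↥(maximalIdeal S ^ (k + 1)), ∃ y : ↥(maximalIdeal S ^ k),
      reesMonomial _ (k + 1) x - reesMonomial _ 1 u * reesMonomial _ k y ∈ P := by
  let q : reesAlgebra (maximalIdeal S) →ₗ[S] reesAlgebra (maximalIdeal S) ⧸ P :=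
    (Ideal.Quotient.mkₐ S P).toLinearMap
  have hq (z) : q z = 0 ↔ z ∈ P := Ideal.Quotient.eq_zero_iff_mem
  have hqm (z w) : q (z * w) = q z * q w := map_mul (Ideal.Quotient.mk P) z w
  let D (k : ℕ) : Submodule S (reesAlgebra (maximalIdeal S) ⧸ P) :=
    LinearMap.range (q ∘ₗ reesMonomial _ k)
  have hD (k) : Module.length S (D k) ≤ c := by
    refine le_trans ?_ (h k)
    refine Module.length_le_of_surjective (Submodule.liftQ _ (q ∘ₗ reesMonomial _ k).rangeRestrict ?_) ?_
    · refine Submodule.smul_le.2 fun a ha x _ => ?_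
      rw [LinearMap.mem_ker, map_smul]
      ext
      change a • q _ = 0
      rw [← map_smul, hq, Algebra.smul_def]
      exact P.mul_mem_right _ (hP a ha)
    · rw [← LinearMap.range_eq_top, Submodule.range_liftQ, LinearMap.range_rangeRestrict]
  obtain ⟨k, hk⟩ : ∃ k, Module.length S (D (k + 1)) ≤ Module.length S (D k) := by
    by_contra! hlt
    have (k : ℕ) : (k : ℕ∞) ≤ Module.length S (D k) := by
      induction k with
      | zero => simp
      | succ k ih => exact_mod_cast Order.add_one_le_of_lt (ih.trans_lt (hlt k))
    have := (this (c + 1)).trans (hD _)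
    norm_cast at this
    omega
  let φ : D k →ₗ[S] D (k + 1) := ((LinearMap.mulLeft S (q (reesMonomial _ 1 u))).comp
      (D k).subtype).codRestrict _ (by
    rintro ⟨_, y, rfl⟩
    refine ⟨⟨y * u, ?_⟩, ?_⟩
    · rw [pow_succ]
      exact Ideal.mul_mem_mul y.2 (by simpa using u.2)
    · change q _ = q _ * q _
      rw [reesMonomial_mul y u _ rfl, mul_comm, hqm])
  have hφ := LinearMap.surjective_of_length_le φ (fun a b hab => by
      have : q (reesMonomial _ 1 u) * (a : _ ⧸ P) = q (reesMonomial _ 1 u) * b :=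
        congr_arg Subtype.val hab
      exact Subtype.ext (mul_left_cancel₀ (fun h0 => hu ((hq _).1 h0)) this))
    (Module.length_ne_top_iff.1 (ne_top_of_le_ne_top (ENat.natCast_ne_top c) (hD k))) hk
  refine ⟨k, fun x => ?_⟩
  obtain ⟨⟨_, y, rfl⟩, hy⟩ := hφ ⟨_, x, rfl⟩
  refine ⟨y, ?_⟩
  rw [← hq, map_sub, hqm, sub_eq_zero]
  exact (congr_arg Subtype.val hy).symm

lemma reesMonomial_one_pow_le (I : Ideal S) (k : ℕ) (P : Ideal (reesAlgebra I))
    (h : ∀ x, reesMonomial I k x ∈ P) :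
    Ideal.span (Set.range (reesMonomial I 1)) ^ k ≤ P := by
  have key : ∀ k, Ideal.span (Set.range (reesMonomial I 1)) ^ k ≤
      Ideal.span (Set.range (reesMonomial I k)) := by
    intro k
    induction k with
    | zero =>
      rw [pow_zero, Ideal.one_eq_top, top_le_iff, Ideal.eq_top_iff_one]
      exact Ideal.subset_span ⟨⟨1, by simp⟩, by ext1; simp [coe_reesMonomial]⟩
    | succ k ih =>
      rw [pow_succ]
      refine (Ideal.mul_mono_left ih).trans ?_
      rw [Ideal.span_mul_span', Ideal.span_le]
      rintro _ ⟨_, ⟨x, rfl⟩, _, ⟨y, rfl⟩, rfl⟩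
      exact Ideal.subset_span ⟨⟨x * y, by
        rw [pow_succ]
        exact Ideal.mul_mem_mul x.2 (by simpa using y.2)⟩, reesMonomial_mul x y _ rfl⟩
  refine (key k).trans (Ideal.span_le.2 ?_)
  rintro _ ⟨x, rfl⟩
  exact h x

lemma reesMonomial_mem_pow (I : Ideal S) (k : ℕ) (x : ↥(I ^ k)) :
    reesMonomial I k x ∈ Ideal.span (Set.range (reesMonomial I 1)) ^ k := by
  induction k with
  | zero => simp
  | succ k ih =>
    obtain ⟨x, hx⟩ := x
    have hx' := hx
    rw [pow_succ] at hx'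
    induction hx' using Submodule.mul_induction_on' with
    | mem_mul_mem a ha b hb =>
      rw [reesMonomial_mul ⟨a, ha⟩ ⟨b, by simpa using hb⟩ _ rfl, pow_succ]
      exact Ideal.mul_mem_mul (ih _) (Ideal.subset_span ⟨_, rfl⟩)
    | add a ha b hb iha ihb =>
      rw [← pow_succ] at ha hb
      exact (map_add (reesMonomial I (k + 1)) ⟨a, ha⟩ ⟨b, hb⟩).symm ▸ add_mem (iha ha) (ihb hb)

lemma coeff_mem_of_mem_map (I : Ideal S) (g : reesAlgebra I)
    (hg : g ∈ I.map (algebraMap S (reesAlgebra I))) (i : ℕ) : (g : S[X]).coeff i ∈ I * I ^ i := by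
  revert i
  induction hg using Submodule.span_induction with
  | mem x hx =>
    obtain ⟨a, ha, rfl⟩ := hx
    intro i
    change (C a).coeff i ∈ _
    rw [coeff_C]
    split_ifs with hi
    · simpa [hi] using ha
    · exact zero_mem _
  | zero => simp
  | add x y _ _ hx hy =>
    intro i
    change ((x : S[X]) + (y : S[X])).coeff i ∈ _
    rw [coeff_add]
    exact add_mem (hx i) (hy i)
  | smul b x _ hx =>
    intro i
    change ((b : S[X]) * (x : S[X])).coeff i ∈ _
    rw [coeff_mul]
    refine Ideal.sum_mem _ fun ⟨j, l⟩ hjl => ?_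
    rw [← Finset.HasAntidiagonal.mem_antidiagonal.1 hjl, pow_add, ← mul_assoc, mul_comm I, mul_assoc]
    exact Ideal.mul_mem_mul (b.2 j) (hx l)

lemma mem_sup_of_reesMonomial_mem {I : Ideal S} {N : ℕ} {u : ↥(I ^ 1)} {x : ↥(I ^ (N + 1))}
    (h : reesMonomial I (N + 1) x ∈
      I.map (algebraMap S (reesAlgebra I)) ⊔ Ideal.span {reesMonomial I 1 u}) :
    (x : S) ∈ Ideal.span {(u : S)} * I ^ N ⊔ I * I ^ (N + 1) := by
  obtain ⟨g, hg, z, hz, hgz⟩ := Submodule.mem_sup.1 h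
  obtain ⟨b, rfl⟩ := Ideal.mem_span_singleton'.1 hz
  have h2 : (g : S[X]).coeff (N + 1) + (b : S[X]).coeff N * u = x := by
    rw [← Polynomial.coeff_monomial_same (N + 1) (x : S), ← coe_reesMonomial, ← hgz,
      ← Polynomial.coeff_mul_monomial, ← Polynomial.coeff_add]
    rfl
  have h3 := Ideal.mul_mem_mul (Ideal.mem_span_singleton_self (u : S)) (b.2 N)
  have h4 := coeff_mem_of_mem_map I g hg (N + 1)
  rw [← h2, add_comm (Polynomial.coeff _ _), mul_comm _ (u : S)]
  exact Submodule.add_mem_sup h3 h4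

/-- A local ring with infinite residue field, the numbers of generators of the powers of whose
maximal ideal are bounded, has a principal reduction of its maximal ideal. -/
theorem exists_maximalIdeal_pow_succ_le [IsLocalRing S] [IsNoetherianRing S]
    [Infinite (ResidueField S)] {c : ℕ}
    (h : ∀ k, Module.length S (↥(maximalIdeal S ^ k) ⧸
      maximalIdeal S • (⊤ : Submodule S ↥(maximalIdeal S ^ k))) ≤ c) :
    ∃ f ∈ maximalIdeal S, ∃ k, maximalIdeal S ^ (k + 1) ≤ Ideal.span {f} * maximalIdeal S ^ k := by
  classical
  set n := maximalIdeal S with hn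
  let B := reesAlgebra n
  let J : Ideal B := n.map (algebraMap S B)
  let Q : Ideal B := Ideal.span (Set.range (reesMonomial n 1))
  have hfin : (J.minimalPrimes).Finite := J.finite_minimalPrimes_of_isNoetherianRing
  obtain ⟨u, -, hu⟩ := exists_mem_forall_notMem (⊤ : Submodule S ↥(n ^ 1))
    (((hfin.toFinset).image fun P => (P.restrictScalars S).comap (reesMonomial n 1)).erase ⊤)
    (by
      intro N hN h'
      exact (Finset.mem_erase.1 hN).1 (top_le_iff.1 h'))
  have hrad : Q ≤ (J ⊔ Ideal.span {reesMonomial n 1 u}).radical := by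
    rw [Ideal.radical_eq_sInf]
    refine le_sInf fun P' ⟨hP', hP'p⟩ => ?_
    obtain ⟨P, hP, hPP'⟩ := Ideal.exists_minimalPrimes_le (le_sup_left.trans hP')
    have hPp : P.IsPrime := hP.1.1
    by_cases htop : (P.restrictScalars S).comap (reesMonomial n 1) = ⊤
    · refine Ideal.span_le.2 ?_
      rintro _ ⟨x, rfl⟩
      exact hPP' (show x ∈ (P.restrictScalars S).comap (reesMonomial n 1) from htop ▸ trivial)
    · have huP : reesMonomial n 1 u ∉ P := hu _ (Finset.mem_erase.2
        ⟨htop, Finset.mem_image_of_mem _ (hfin.mem_toFinset.2 hP)⟩)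
      obtain ⟨k, hk⟩ := exists_mul_reesMonomial_eq h P
        (fun a ha => hP.1.2 (Ideal.mem_map_of_mem _ ha)) huP
      refine hP'p.le_of_pow_le (reesMonomial_one_pow_le n (k + 1) P' fun x => ?_)
      obtain ⟨y, hy⟩ := hk x
      have h1 : reesMonomial n 1 u ∈ P' :=
        hP' (Ideal.mem_sup_right (Ideal.mem_span_singleton_self _))
      have := P'.add_mem (hPP' hy) (P'.mul_mem_right (reesMonomial n k y) h1)
      rwa [sub_add_cancel] at this
  obtain ⟨N, hN⟩ := Ideal.exists_pow_le_of_le_radical_of_fg hrad (IsNoetherian.noetherian Q)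
  refine ⟨u, by simpa using u.2, N, ?_⟩
  refine Submodule.le_of_le_smul_of_le_jacobson_bot (I := n) (IsNoetherian.noetherian _)
    (IsLocalRing.maximalIdeal_le_jacobson _) fun x hx => ?_
  exact mem_sup_of_reesMonomial_mem
    (hN (Ideal.pow_le_pow_right N.le_succ (reesMonomial_mem_pow n (N + 1) ⟨x, hx⟩)))

end Reduction

section HilbertFunction

open IsLocalRing nonZeroDivisors Pointwise

lemma length_quotient_smul {S M : Type*} [CommRing S] [AddCommGroup M] [Module S M] {f : S}
    (hf : ∀ x : M, f • x = 0 → x = 0) (N : Submodule S M) :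
    Module.length S (M ⧸ f • N) = Module.length S (M ⧸ N) + Module.length S (QuotSMulTop f M) := by
  have hle : N ≤ (f • N).comap (LinearMap.lsmul S M f) := fun x hx => ⟨x, hx, rfl⟩
  have hle' : f • N ≤ f • (⊤ : Submodule S M) := Submodule.map_mono le_top
  refine Module.length_eq_add_of_exact (N.mapQ (f • N) (LinearMap.lsmul S M f) hle)
    (Submodule.factor hle') ?_ (Submodule.factor_surjective hle') ?_
  · rw [injective_iff_map_eq_zero]
    intro x hx
    obtain ⟨x, rfl⟩ := N.mkQ_surjective x
    obtain ⟨y, hy, hxy⟩ := (Submodule.Quotient.mk_eq_zero _).1 hx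
    have : y = x := sub_eq_zero.1 (hf _ (by rw [smul_sub, sub_eq_zero]; exact hxy))
    exact (Submodule.Quotient.mk_eq_zero _).2 (this ▸ hy)
  · intro y
    obtain ⟨y, rfl⟩ := (f • N).mkQ_surjective y
    constructor
    · intro h
      obtain ⟨x, -, rfl⟩ := (Submodule.Quotient.mk_eq_zero _).1 h
      exact ⟨N.mkQ x, rfl⟩
    · rintro ⟨x, hx⟩
      obtain ⟨x, rfl⟩ := N.mkQ_surjective x
      rw [← hx]
      exact (Submodule.Quotient.mk_eq_zero _).2 ⟨x, trivial, rfl⟩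

lemma length_quotSMulTop_of_injective {S M L : Type*} [CommRing S] [AddCommGroup M] [Module S M]
    [AddCommGroup L] [Module S L] {f : S} (hf : ∀ x : M, f • x = 0 → x = 0) (j : L →ₗ[S] M)
    (hj : Function.Injective j) (hfin : IsFiniteLength S (M ⧸ LinearMap.range j)) :
    Module.length S (QuotSMulTop f L) = Module.length S (QuotSMulTop f M) := by
  have h1 := length_quotient_smul hf (LinearMap.range j)
  have hle : f • LinearMap.range j ≤ LinearMap.range j := by
    rintro _ ⟨_, ⟨x, rfl⟩, rfl⟩
    exact ⟨f • x, by simp⟩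
  have hle' : f • (⊤ : Submodule S L) ≤ (f • LinearMap.range j).comap j := by
    rintro _ ⟨x, -, rfl⟩
    exact ⟨j x, ⟨x, rfl⟩, by simp⟩
  have h2 := Module.length_eq_add_of_exact (Submodule.mapQ _ (f • LinearMap.range j) j hle')
    (Submodule.factor hle) (by
      rw [injective_iff_map_eq_zero]
      intro x hx
      obtain ⟨x, rfl⟩ := Submodule.mkQ_surjective _ x
      obtain ⟨_, ⟨y, rfl⟩, hxy⟩ := (Submodule.Quotient.mk_eq_zero _).1 hx
      refine (Submodule.Quotient.mk_eq_zero _).2 ⟨y, trivial, hj ?_⟩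
      rw [← hxy]
      exact map_smul j f y) (Submodule.factor_surjective hle) (by
      intro y
      obtain ⟨y, rfl⟩ := Submodule.mkQ_surjective _ y
      constructor
      · intro h
        obtain ⟨x, rfl⟩ := (Submodule.Quotient.mk_eq_zero _).1 h
        exact ⟨Submodule.mkQ _ x, rfl⟩
      · rintro ⟨x, hx⟩
        obtain ⟨x, rfl⟩ := Submodule.mkQ_surjective _ x
        rw [← hx]
        exact (Submodule.Quotient.mk_eq_zero _).2 ⟨x, rfl⟩)
  rw [h1, add_comm] at h2
  exact (ENat.add_left_injective_of_ne_top (Module.length_ne_top_iff.2 hfin) h2).symm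

lemma length_quotSMulTop_self {S : Type*} [CommRing S] (f : S) :
    Module.length S (QuotSMulTop f S) = Module.length S (S ⧸ Ideal.span {f}) := by
  have h : f • (⊤ : Submodule S S) = Ideal.span {f} := by
    rw [← Submodule.ideal_span_singleton_smul, smul_eq_mul, Ideal.mul_top]
  rw [← h]

/-- The multiplicity is the colength of a principal reduction of the maximal ideal. -/
theorem exists_reduction_length_eq {S : Type*} [CommRing S] [IsLocalRing S] [IsNoetherianRing S]
    [Infinite (ResidueField S)] {t : S} (ht : t ∈ S⁰) (htm : t ∈ maximalIdeal S)
    (hlen : ∀ k, IsFiniteLength S (S ⧸ maximalIdeal S ^ k))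
    (hfin : IsFiniteLength S (S ⧸ Ideal.span {t})) :
    ∃ f ∈ maximalIdeal S, ∃ N, f ∣ t ^ N ∧ ∀ n ≥ N, Module.length S (S ⧸ maximalIdeal S ^ (n + 1)) =
      Module.length S (S ⧸ maximalIdeal S ^ n) + Module.length S (S ⧸ Ideal.span {f}) := by
  obtain ⟨c, hc⟩ := ENat.ne_top_iff_exists.1 (Module.length_ne_top_iff.2 hfin)
  obtain ⟨f, hf, k, hk⟩ := exists_maximalIdeal_pow_succ_le (S := S) (c := c) fun k => by
    have := length_quotSMulTop_of_injective (S := S) (f := t)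
      (fun x hx => (mem_nonZeroDivisors_iff.1 ht).1 x hx) (maximalIdeal S ^ k).subtype
      (Submodule.injective_subtype _) (by rw [Submodule.range_subtype]; exact hlen k)
    rw [length_quotSMulTop_self, ← hc] at this
    rw [← this]
    refine Module.length_le_of_surjective (Submodule.factor ?_) (Submodule.factor_surjective _)
    rw [← Submodule.ideal_span_singleton_smul]
    exact Submodule.smul_mono_left ((Ideal.span_singleton_le_iff_mem _).2 htm)
  have htk : t ^ (k + 1) ∈ Ideal.span {f} := by
    have h1 : t ^ (k + 1) ∈ maximalIdeal S ^ (k + 1) := Ideal.pow_mem_pow htm _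
    exact (hk.trans Ideal.mul_le_left) h1
  have hdvd := Ideal.mem_span_singleton.1 htk
  have hf0 : f ∈ S⁰ := by
    obtain ⟨g, hg⟩ := hdvd
    have := pow_mem ht (k + 1)
    rw [hg] at this
    exact (mul_mem_nonZeroDivisors.1 this).1
  have hpow (n : ℕ) (hn : k + 1 ≤ n) : maximalIdeal S ^ (n + 1) = f • maximalIdeal S ^ n := by
    rw [← Submodule.ideal_span_singleton_smul, smul_eq_mul]
    apply le_antisymm
    · obtain ⟨m, rfl⟩ := Nat.exists_eq_add_of_le hn
      calc maximalIdeal S ^ (k + 1 + m + 1) = maximalIdeal S ^ (k + 1) * maximalIdeal S ^ (m + 1) := by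
            rw [← pow_add]; congr 1
        _ ≤ _ := Ideal.mul_mono_left hk
        _ = _ := by rw [mul_assoc, ← pow_add]; congr 2; omega
    · rw [pow_succ']
      exact Ideal.mul_mono_left ((Ideal.span_singleton_le_iff_mem _).2 hf)
  refine ⟨f, hf, k + 1, hdvd, fun n hn => ?_⟩
  rw [hpow n hn, ← length_quotSMulTop_self]
  exact length_quotient_smul (fun x hx => (mem_nonZeroDivisors_iff.1 hf0).1 x hx) _

end HilbertFunction

section InfiniteResidueField

open IsLocalRing Polynomial

/-- Every local ring has a flat local extension `R(X)` with infinite residue field and the same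
maximal ideal. -/
theorem exists_flat_infinite_residueField (R : Type u) [CommRing R] [IsLocalRing R]
    [IsNoetherianRing R] :
    ∃ (S : Type u) (_ : CommRing S) (_ : Algebra R S) (_ : IsLocalRing S), IsNoetherianRing S ∧
      Module.Flat R S ∧ IsLocalHom (algebraMap R S) ∧ Infinite (ResidueField S) ∧
      (maximalIdeal R).map (algebraMap R S) = maximalIdeal S := by
  let P : Ideal R[X] := (maximalIdeal R).map C
  have : P.IsPrime := Ideal.isPrime_map_C_of_isPrime
  let S := Localization.AtPrime P
  have hflat : Module.Flat R[X] S := IsLocalization.flat S P.primeCompl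
  have hmap : (maximalIdeal R).map (algebraMap R S) = maximalIdeal S := by
    rw [IsScalarTower.algebraMap_eq R R[X] S, ← Ideal.map_map]
    exact Localization.AtPrime.map_eq_maximalIdeal
  refine ⟨S, inferInstance, inferInstance, inferInstance,
    IsLocalization.isNoetherianRing P.primeCompl S inferInstance, Module.Flat.trans R R[X] S, ?_, ?_,
    hmap⟩
  · refine ((IsLocalRing.local_hom_TFAE (algebraMap R S)).out 0 2).2 hmap.le
  · refine Infinite.of_injective (fun i : ℕ => residue S (algebraMap R[X] S (X ^ i))) ?_
    intro i j hij
    by_contra hne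
    have h1 : algebraMap R[X] S (X ^ i - X ^ j) ∈ maximalIdeal S := by
      rw [← residue_eq_zero_iff, map_sub, map_sub, sub_eq_zero]
      exact hij
    rw [IsLocalization.AtPrime.to_map_mem_maximal_iff S P] at h1
    have h2 := Ideal.mem_map_C_iff.1 h1 i
    rw [coeff_sub, coeff_X_pow_self, coeff_X_pow, if_neg hne, sub_zero] at h2
    exact (Ideal.ne_top_iff_one _).1 (maximalIdeal.isMaximal R).ne_top h2

end InfiniteResidueField

section BaseChange

open IsLocalRing nonZeroDivisors Pointwise

lemma exists_injective_quotSMulTop_baseChange {R S M : Type*} [CommRing R] [CommRing S]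
    [Algebra R S] [AddCommGroup M] [Module R M] (c : R) :
    ∃ e : QuotSMulTop (algebraMap R S c) (S ⊗[R] M) →ₗ[S] S ⊗[R] QuotSMulTop c M,
      Function.Injective e ∧ ∀ x, e (QuotSMulTop.proj (algebraMap R S c) (S ⊗[R] M) x) =
        (QuotSMulTop.proj c M).baseChange S x := by
  have hexact : Function.Exact (LinearMap.lsmul R M c) (QuotSMulTop.proj c M) := fun x =>
    QuotSMulTop.proj_eq_zero c x
  have hS (x : S ⊗[R] M) : (LinearMap.lsmul R M c).lTensor S x = algebraMap R S c • x := by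
    induction x with
    | zero => simp
    | add x y hx hy => rw [map_add, hx, hy, smul_add]
    | tmul a y => simp
  have hS' := lTensor_exact S hexact (QuotSMulTop.proj_surjective c)
  have hker (x : S ⊗[R] M) :
      (QuotSMulTop.proj c M).baseChange S x = 0 ↔ ∃ y, algebraMap R S c • y = x := by
    simp_rw [← hS]
    exact hS' x
  obtain ⟨e, he⟩ := QuotSMulTop.exists_comp_proj_eq (algebraMap R S c)
    ((QuotSMulTop.proj c M).baseChange S) fun x => by
      rw [← map_smul, hker]
      exact ⟨x, rfl⟩
  refine ⟨e, (injective_iff_map_eq_zero e).2 fun x hx => ?_, he⟩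
  obtain ⟨x, rfl⟩ := QuotSMulTop.proj_surjective _ x
  rw [he, hker] at hx
  exact (QuotSMulTop.proj_eq_zero _ x).2 hx

variable {R S M : Type*} [CommRing R] [CommRing S] [Algebra R S] [AddCommGroup M] [Module R M]

lemma exists_eq_smul_proj_baseChange [IsNoetherianRing R] [Module.Finite R M] [Module.Flat R S]
    {c : R} (h : ∀ φ : M →ₗ[R] QuotSMulTop c M, ∃ b : R, φ = b • QuotSMulTop.proj c M)
    (φ : S ⊗[R] M →ₗ[S] QuotSMulTop (algebraMap R S c) (S ⊗[R] M)) :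
    ∃ b : S, ∀ x, φ x = b • QuotSMulTop.proj (algebraMap R S c) (S ⊗[R] M) x := by
  have : Module.FinitePresentation R M := Module.finitePresentation_of_finite R M
  obtain ⟨e, heinj, he⟩ := exists_injective_quotSMulTop_baseChange (S := S) (M := M) c
  have key : ∃ b : S, e ∘ₗ φ = b • (QuotSMulTop.proj c M).baseChange S := by
    refine (Module.FinitePresentation.isBaseChange_map R M (QuotSMulTop c M) S).inductionOn
      (e ∘ₗ φ) (fun ψ => ∃ b : S, ψ = b • (QuotSMulTop.proj c M).baseChange S)
      ⟨0, by simp⟩ ?_ ?_ ?_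
    · intro g
      obtain ⟨b, rfl⟩ := h g
      exact ⟨algebraMap R S b, by
        rw [LinearMap.baseChangeHom_apply, LinearMap.baseChange_smul, algebraMap_smul]⟩
    · rintro s _ ⟨b, rfl⟩
      exact ⟨s * b, by rw [mul_smul]⟩
    · rintro _ _ ⟨b, rfl⟩ ⟨b', rfl⟩
      exact ⟨b + b', by rw [add_smul]⟩
  obtain ⟨b, hb⟩ := key
  refine ⟨b, fun x => heinj ?_⟩
  rw [map_smul, he]
  exact LinearMap.congr_fun hb x

variable [IsLocalRing R] [IsLocalRing S] [Module.Flat R S] [IsLocalHom (algebraMap R S)]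

lemma length_baseChange_of_map_eq (hm : (maximalIdeal R).map (algebraMap R S) = maximalIdeal S) :
    Module.length S (S ⊗[R] M) = Module.length R M := by
  have : IsSimpleModule S (S ⧸ maximalIdeal S) :=
    isSimpleModule_iff_isCoatom.2 (Ideal.isMaximal_def.1 (maximalIdeal.isMaximal S))
  rw [IsLocalRing.length_baseChange, hm, Module.length_eq_one_iff.2 this, mul_one]

lemma length_quotient_map (hm : (maximalIdeal R).map (algebraMap R S) = maximalIdeal S)
    (J : Ideal R) :
    Module.length S (S ⧸ J.map (algebraMap R S)) = Module.length R (R ⧸ J) := by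
  rw [← length_baseChange_of_map_eq (S := S) hm]
  exact (Algebra.TensorProduct.quotIdealMapEquivTensorQuot S J).toLinearEquiv.length_eq

lemma length_quotient_maximalIdeal_smul_baseChange
    (hm : (maximalIdeal R).map (algebraMap R S) = maximalIdeal S) :
    Module.length S ((S ⊗[R] M) ⧸ maximalIdeal S • (⊤ : Submodule S (S ⊗[R] M))) =
      Module.length R (M ⧸ maximalIdeal R • (⊤ : Submodule R M)) := by
  rw [← length_baseChange_of_map_eq (S := S) hm, ← hm]
  exact (tensorQuotMapSMulEquivTensorQuot M S (maximalIdeal R)).length_eq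

lemma length_localSocle_le_baseChange
    (hm : (maximalIdeal R).map (algebraMap R S) = maximalIdeal S) :
    Module.length R (localSocle R M) ≤ Module.length S (localSocle S (S ⊗[R] M)) := by
  rw [← length_baseChange_of_map_eq (S := S) hm]
  let g := (localSocle R M).subtype.baseChange S
  have hg : Function.Injective g :=
    Module.Flat.lTensor_preserves_injective_linearMap (M := S) _ (Submodule.injective_subtype _)
  have hmem (x) : g x ∈ localSocle S (S ⊗[R] M) := by
    induction x with
    | zero => simp
    | add x y hx hy => rw [map_add]; exact add_mem hx hy
    | tmul s x =>
      rw [mem_localSocle, ← hm]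
      intro a ha
      induction ha using Submodule.span_induction with
      | zero => simp
      | add _ _ _ _ h1 h2 => rw [add_smul, h1, h2, add_zero]
      | smul b _ _ h1 => rw [smul_assoc, h1, smul_zero]
      | mem a ha =>
        obtain ⟨a, ha, rfl⟩ := ha
        rw [algebraMap_smul]
        change a • s ⊗ₜ[R] (x : M) = 0
        rw [← TensorProduct.tmul_smul, mem_localSocle.1 x.2 a ha, TensorProduct.tmul_zero]
  exact Module.length_le_of_injective (g.codRestrict _ hmem) fun x y hxy =>
    hg (congr_arg Subtype.val hxy)

lemma exists_injective_baseChange_ideal [IsNoetherianRing S]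
    (hm : (maximalIdeal R).map (algebraMap R S) = maximalIdeal S) {I : Ideal R} {a : R}
    (haI : a ∈ I) (ha : IsFiniteLength R (R ⧸ Ideal.span {a})) :
    ∃ j : S ⊗[R] I →ₗ[S] S, Function.Injective j ∧ IsFiniteLength S (S ⧸ LinearMap.range j) := by
  let e := AlgebraTensorModule.rid R S S
  have hi : Function.Injective (I.subtype.baseChange S) :=
    Module.Flat.lTensor_preserves_injective_linearMap (M := S) _ (Submodule.injective_subtype _)
  refine ⟨e.toLinearMap ∘ₗ I.subtype.baseChange S, e.injective.comp hi, ?_⟩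
  refine isFiniteLength_of_forall_smul_eq_zero (c := algebraMap R S a) ?_ fun x => ?_
  · rw [← Module.length_ne_top_iff, ← Set.image_singleton, ← Ideal.map_span,
      length_quotient_map hm, Module.length_ne_top_iff]
    exact ha
  · obtain ⟨x, rfl⟩ := Submodule.mkQ_surjective _ x
    rw [← map_smul]
    refine (Submodule.Quotient.mk_eq_zero _).2 ⟨x ⊗ₜ ⟨a, haI⟩, ?_⟩
    change a • x = _
    rw [algebraMap_smul]

end BaseChange

section Divisor

open IsLocalRing Pointwise

variable {S L : Type*} [CommRing S] [AddCommGroup L] [Module S L] {f h : S}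

lemma exists_injective_quotSMulTop_mul (hL : ∀ x : L, (f * h) • x = 0 → x = 0) :
    ∃ θ : QuotSMulTop f L →ₗ[S] QuotSMulTop (f * h) L, Function.Injective θ ∧
      ∀ x, θ (QuotSMulTop.proj f L x) = QuotSMulTop.proj (f * h) L (h • x) := by
  obtain ⟨θ, hθ⟩ := QuotSMulTop.exists_comp_proj_eq f
    (QuotSMulTop.proj (f * h) L ∘ₗ LinearMap.lsmul S L h) fun x => by
      rw [← map_smul, LinearMap.comp_apply, QuotSMulTop.proj_eq_zero]
      exact ⟨x, by rw [LinearMap.lsmul_apply, smul_smul, mul_comm f h]⟩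
  refine ⟨θ, (injective_iff_map_eq_zero θ).2 fun x hx => ?_, hθ⟩
  obtain ⟨x, rfl⟩ := QuotSMulTop.proj_surjective _ x
  rw [hθ, LinearMap.comp_apply, QuotSMulTop.proj_eq_zero] at hx
  obtain ⟨y, hy⟩ := hx
  refine (QuotSMulTop.proj_eq_zero _ _).2 ⟨y, sub_eq_zero.1 (hL _ ?_)⟩
  change (f * h) • y = h • x at hy
  rw [mul_smul, smul_sub, ← hy, smul_smul h f, mul_comm h f, sub_self, smul_zero]

lemma exists_eq_smul_of_end_quotSMulTop_of_dvd (hL : ∀ x : L, (f * h) • x = 0 → x = 0)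
    (hφ : ∀ φ : L →ₗ[S] QuotSMulTop (f * h) L,
      ∃ b : S, ∀ x, φ x = b • QuotSMulTop.proj (f * h) L x)
    (ψ : QuotSMulTop f L →ₗ[S] QuotSMulTop f L) : ∃ b : S, ∀ x, ψ x = b • x := by
  obtain ⟨θ, -, hθ⟩ := exists_injective_quotSMulTop_mul hL
  have hh (x : L) (hx : h • x = 0) : x = 0 := hL x (by rw [mul_smul, hx, smul_zero])
  obtain ⟨a, ha⟩ := hφ (θ ∘ₗ ψ ∘ₗ QuotSMulTop.proj f L)
  have key (x : L) : ∃ y, h • y = a • x ∧ QuotSMulTop.proj f L y = ψ (QuotSMulTop.proj f L x) := by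
    obtain ⟨y, hy⟩ := QuotSMulTop.proj_surjective f (ψ (QuotSMulTop.proj f L x))
    have h1 := ha x
    rw [LinearMap.comp_apply, LinearMap.comp_apply, ← hy, hθ, ← map_smul, eq_comm, ← sub_eq_zero,
      ← map_sub, QuotSMulTop.proj_eq_zero] at h1
    obtain ⟨z, hz⟩ := h1
    refine ⟨y + f • z, ?_, ?_⟩
    · rw [smul_add, smul_smul, mul_comm h f, hz, add_sub_cancel]
    · rw [map_add, map_smul, QuotSMulTop.smul_eq_zero, add_zero, hy]
  obtain ⟨g, hg⟩ := LinearMap.exists_smul_eq_of_forall_exists hh (LinearMap.lsmul S L a)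
    fun x => (key x).imp fun _ hy => hy.1
  obtain ⟨b, hb⟩ := hφ (QuotSMulTop.proj (f * h) L ∘ₗ g)
  refine ⟨b, fun x => ?_⟩
  obtain ⟨x, rfl⟩ := QuotSMulTop.proj_surjective f x
  obtain ⟨y, hy, hy'⟩ := key x
  have hgy : g x = y := sub_eq_zero.1 (hh _ (by
    rw [smul_sub, hy, hg, LinearMap.lsmul_apply, sub_self]))
  have h1 := hb x
  rw [LinearMap.comp_apply, ← map_smul, ← sub_eq_zero, ← map_sub, QuotSMulTop.proj_eq_zero, hgy] at h1
  obtain ⟨z, hz⟩ := h1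
  rw [← hy', ← map_smul, ← sub_eq_zero, ← map_sub, QuotSMulTop.proj_eq_zero, ← hz]
  exact ⟨h • z, by rw [smul_smul]⟩

lemma length_localSocle_le_of_dvd [IsLocalRing S] (hL : ∀ x : L, (f * h) • x = 0 → x = 0)
    (hf : f ∈ maximalIdeal S) :
    Module.length S (localSocle S (QuotSMulTop (f * h) L)) ≤
      Module.length S (localSocle S (QuotSMulTop f L)) := by
  obtain ⟨θ, hθinj, hθ⟩ := exists_injective_quotSMulTop_mul hL
  have hle : localSocle S (QuotSMulTop (f * h) L) ≤
      LinearMap.range (θ ∘ₗ (localSocle S (QuotSMulTop f L)).subtype) := by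
    intro y hy
    rw [mem_localSocle] at hy
    obtain ⟨y, rfl⟩ := QuotSMulTop.proj_surjective _ y
    have h1 := hy f hf
    rw [← map_smul, QuotSMulTop.proj_eq_zero] at h1
    obtain ⟨z, hz⟩ := h1
    have hyz : h • z = y := sub_eq_zero.1 (hL _ (by
      rw [mul_comm, mul_smul, smul_sub, smul_smul, hz, sub_self, smul_zero]))
    refine ⟨⟨QuotSMulTop.proj f L z, mem_localSocle.2 fun a ha => hθinj ?_⟩, ?_⟩
    · rw [map_smul, map_zero, hθ, hyz, hy a ha]
    · exact (hθ z).trans (by rw [hyz])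
  exact (Module.length_le_of_injective (Submodule.inclusion hle)
    (Submodule.inclusion_injective hle)).trans
    (Module.length_le_of_surjective _ (LinearMap.surjective_rangeRestrict _))

lemma length_quotient_maximalIdeal_smul_le [IsLocalRing S] (hf : f ∈ maximalIdeal S) :
    Module.length S (L ⧸ maximalIdeal S • (⊤ : Submodule S L)) ≤
      Module.length S (QuotSMulTop f L ⧸ maximalIdeal S • (⊤ : Submodule S (QuotSMulTop f L))) := by
  obtain ⟨g, hg⟩ := QuotSMulTop.exists_comp_proj_eq f
    (Submodule.mkQ (maximalIdeal S • (⊤ : Submodule S L))) fun x => by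
      rw [← map_smul]
      exact (Submodule.Quotient.mk_eq_zero _).2 (Submodule.smul_mem_smul hf trivial)
  refine Module.length_le_of_surjective (Submodule.liftQ _ g ?_) ?_
  · refine Submodule.smul_le.2 fun a ha x _ => ?_
    obtain ⟨x, rfl⟩ := QuotSMulTop.proj_surjective _ x
    rw [LinearMap.mem_ker, map_smul, hg, ← map_smul]
    exact (Submodule.Quotient.mk_eq_zero _).2 (Submodule.smul_mem_smul ha trivial)
  · intro y
    obtain ⟨y, rfl⟩ := Submodule.mkQ_surjective _ y
    exact ⟨Submodule.mkQ _ (QuotSMulTop.proj f L y), hg y⟩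

end Divisor

section Main

open IsLocalRing nonZeroDivisors

lemma isMultiplicityAt_of_length_quotient_map {R S : Type*} [CommRing R] [CommRing S]
    [Algebra R S] [IsLocalRing R] [IsLocalRing S] [Module.Flat R S] [IsLocalHom (algebraMap R S)]
    (hm : (maximalIdeal R).map (algebraMap R S) = maximalIdeal S) {e N : ℕ}
    (h : ∀ n ≥ N, Module.length S (S ⧸ maximalIdeal S ^ (n + 1)) =
      Module.length S (S ⧸ maximalIdeal S ^ n) + e) :
    IsMultiplicityAt R (maximalIdeal R) e := by
  have key (n : ℕ) : moduleLength R (R ⧸ maximalIdeal R ^ n) =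
      Module.length S (S ⧸ maximalIdeal S ^ n) := by
    rw [moduleLength, ← Module.length_eq_height, ← length_quotient_map (S := S) hm, Ideal.map_pow,
      hm]
  exact ⟨N, fun n hn => by rw [key, key, h n hn]⟩

lemma length_localSocle_le_of_injective {S M N : Type*} [CommRing S] [IsLocalRing S]
    [AddCommGroup M] [Module S M] [AddCommGroup N] [Module S N] (g : M →ₗ[S] N)
    (hg : Function.Injective g) :
    Module.length S (localSocle S M) ≤ Module.length S (localSocle S N) := by
  have h (x : localSocle S M) : g x ∈ localSocle S N :=
    mem_localSocle.2 fun a ha => by rw [← map_smul, mem_localSocle.1 x.2 a ha, map_zero]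
  refine Module.length_le_of_injective ((g ∘ₗ (localSocle S M).subtype).codRestrict _ h) ?_
  exact fun x y hxy => Subtype.ext (hg (congr_arg Subtype.val hxy))

lemma IsFiniteLength.of_span_singleton_le {S : Type*} [CommRing S] {t : S} {J : Ideal S}
    (h : IsFiniteLength S (S ⧸ Ideal.span {t})) (ht : t ∈ J) : IsFiniteLength S (S ⧸ J) :=
  h.of_surjective (f := Submodule.factor ((Ideal.span_singleton_le_iff_mem _).2 ht))
    (Submodule.factor_surjective _)

/-- The multiplicity of a one-dimensional local ring is at least `(r + 1) * s + 1`, as soon as there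
is an ideal with `r` generators whose canonical dual has `s` generators, for which the evaluation
map to the canonical module is an isomorphism. -/
theorem IsCanonicalModuleAt.exists_isMultiplicityAt {R : Type u} [CommRing R] [IsLocalRing R]
    [IsNoetherianRing R] [Ring.KrullDimLE 1 R] {K : Type u} [AddCommGroup K] [Module R K]
    [Nontrivial K] (hK : IsCanonicalModuleAt R (maximalIdeal R) K) {t a : R} (ht : t ∈ R⁰)
    (htm : t ∈ maximalIdeal R) {I : Ideal R} (ha : a ∈ R⁰) (haI : a ∈ I)
    (hev : Function.Bijective (evalMap R I K)) (hr : 2 ≤ minGen R I)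
    (hs : 2 ≤ minGen R (⊤ : Submodule R (I →ₗ[R] K))) :
    ∃ e : ℕ, IsMultiplicityAt R (maximalIdeal R) e ∧
      (minGen R I + 1) * minGen R (⊤ : Submodule R (I →ₗ[R] K)) < e := by
  obtain ⟨S, _, _, _, _, _, _, _, hm⟩ := exists_flat_infinite_residueField R
  have hreg (c : R) (hc : c ∈ R⁰) : algebraMap R S c ∈ S⁰ := by
    rw [mem_nonZeroDivisors_iff_right]
    intro x hx
    refine Module.Flat.isSMulRegular_of_nonZeroDivisors (M := S) hc ?_
    change c • x = c • (0 : S)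
    rw [smul_zero, Algebra.smul_def, mul_comm, hx]
  have hfin (c : R) (hc : c ∈ R⁰) : IsFiniteLength S (S ⧸ Ideal.span {algebraMap R S c}) := by
    rw [← Module.length_ne_top_iff, ← Set.image_singleton, ← Ideal.map_span,
      length_quotient_map hm, Module.length_ne_top_iff]
    exact isFiniteLength_quotient_span_singleton R hc
  have hmem (c : R) (hc : c ∈ maximalIdeal R) : algebraMap R S c ∈ maximalIdeal S := by
    rw [← hm]
    exact Ideal.mem_map_of_mem _ hc
  obtain ⟨f, hf, N, ⟨h, hfh⟩, hN⟩ := exists_reduction_length_eq (hreg t ht) (hmem t htm)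
    (fun k => (hfin _ (pow_mem ht k)).of_span_singleton_le (by
      rw [map_pow]
      exact Ideal.pow_mem_pow (hmem t htm) k)) (hfin t ht)
  let c := t ^ (N + 1)
  have hc : c ∈ R⁰ := pow_mem ht _
  have hcm : c ∈ maximalIdeal R := Ideal.pow_mem_of_mem _ htm _ N.succ_pos
  have hcf : algebraMap R S c = f * (h * algebraMap R S t) := by
    rw [map_pow, pow_succ, hfh, mul_assoc]
  have hf0 : f ∈ S⁰ := (mul_mem_nonZeroDivisors.1 (hcf ▸ hreg c hc)).1
  have hffin : IsFiniteLength S (S ⧸ Ideal.span {f}) :=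
    (hfin c hc).of_span_singleton_le (Ideal.mem_span_singleton.2 ⟨_, hcf⟩)
  obtain ⟨j, hj, hjfin⟩ := exists_injective_baseChange_ideal hm haI
    (isFiniteLength_quotient_span_singleton R ha)
  have htors (x : S ⊗[R] I) (hx : algebraMap R S c • x = 0) : x = 0 := by
    apply hj
    have := congr_arg j hx
    rw [map_smul, map_zero, smul_eq_mul, mul_comm] at this
    rw [map_zero]
    exact (mem_nonZeroDivisors_iff_right.1 (hreg c hc)) _ this
  have hsoc : (minGen R (⊤ : Submodule R (I →ₗ[R] K)) : ℕ∞) ≤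
      Module.length S (localSocle S (QuotSMulTop (algebraMap R S c) (S ⊗[R] I))) := by
    refine (hK.minGen_le_length_localSocle hc hcm ha haI).trans
      ((length_localSocle_le_baseChange (S := S) hm).trans
        (length_localSocle_le_of_injective _
          (QuotSMulTop.algebraMapTensorEquivTensorQuotSMulTop c I S).symm.injective))
  have hend (φ) := exists_eq_smul_proj_baseChange (S := S)
    (hK.exists_eq_smul_proj hc hcm ha haI hev) φ
  rw [hcf] at htors hsoc
  have hlen : Module.length S (S ⧸ Ideal.span {f}) =
      Module.length S (QuotSMulTop f (S ⊗[R] I)) := by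
    rw [length_quotSMulTop_of_injective (fun x hx => (mem_nonZeroDivisors_iff.1 hf0).1 x hx) j hj
      hjfin, length_quotSMulTop_self]
  obtain ⟨e, he⟩ := ENat.ne_top_iff_exists.1 (Module.length_ne_top_iff.2 hffin)
  refine ⟨e, isMultiplicityAt_of_length_quotient_map hm (he ▸ hN), ?_⟩
  have := lt_length_quotient_of_forall_end_eq_smul (M := QuotSMulTop f (S ⊗[R] I)) (f := f)
    (isFiniteLength_of_forall_smul_eq_zero hffin (QuotSMulTop.smul_eq_zero f))
    (QuotSMulTop.smul_eq_zero f)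
    (exists_eq_smul_of_end_quotSMulTop_of_dvd htors (hcf ▸ hend)) hlen.le hr hs
    ((minGen_le_length (IsNoetherian.noetherian I)).trans
      ((length_quotient_maximalIdeal_smul_baseChange (S := S) hm).symm.le.trans
        (length_quotient_maximalIdeal_smul_le hf)))
    (hsoc.trans (length_localSocle_le_of_dvd htors hf))
  rw [← he] at this
  exact_mod_cast this

end Main

/-- (Theorem 1.4 (1)) If the canonical map
`t : I ⊗_R Hom_R(I, K_R) → K_R` is an isomorphism and `r = μ_R(I) ≥ 2`,
`s = μ_R(Hom_R(I, K_R)) ≥ 2`, then `e(R) > (r+1)s ≥ 6`. -/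
theorem stmt4 (R : Type u) [CommRing R] [IsLocalRing R]
    (hCM : IsOneDimCMLocal R)
    (K : Type u) [AddCommGroup K] [Module R K]
    (hK : IsCanonicalModuleAt R (IsLocalRing.maximalIdeal R) K)
    (I : Ideal R) (hfaith : Module.annihilator R ↥I = ⊥)
    (r s : ℕ) (hr : r = minGen R (I : Submodule R R))
    (hs : s = minGen R (⊤ : Submodule R (↥I →ₗ[R] K)))
    (ht : Function.Bijective (evalMap R (I : Submodule R R) K))
    (hr2 : 2 ≤ r) (hs2 : 2 ≤ s) :
    6 ≤ (r + 1) * s ∧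
      ∃ e : ℕ, IsMultiplicityAt R (IsLocalRing.maximalIdeal R) e ∧ (r + 1) * s < e := by
  refine ⟨by nlinarith, ?_⟩
  obtain ⟨hNoeth, hdim, t, htm, ht0⟩ := hCM
  have : Ring.KrullDimLE 1 R := Ring.krullDimLE_iff.2 (by rw [hdim]; rfl)
  obtain ⟨a, haI, ha⟩ : ∃ a, a ∈ (I : Set R) ∧ a ∈ nonZeroDivisors R := by
    by_contra! h
    exact (Ideal.bot_lt_annihilator_of_disjoint_nonZeroDivisors
      (Set.disjoint_left.2 h)).ne' hfaith
  have : Nontrivial K := by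
    by_contra h
    rw [not_nontrivial_iff_subsingleton] at h
    have : minGen R (⊤ : Submodule R (↥I →ₗ[R] K)) ≤ 0 :=
      Nat.sInf_le ⟨∅, rfl, Subsingleton.elim _ _⟩
    omega
  subst hr hs
  exact hK.exists_isMultiplicityAt ht0 htm ha haI ht hr2 hs2

end
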